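/- For every integer L ≥ 1 there exists ℓ₀ > 1 such that for all ℓ₋, ℓ₊ with ℓ = min(ℓ₋, ℓ₊) ≥ ℓ₀ there exists θ₀ > 0 such that for all θ ∈ (0, θ₀) the following holds: if #{1 ≤ j < q : f^j(0) < 0} ≤ L and h^{(0)}, h^{(1)}, …, h^{(q−1)} are θ-regular holomorphic motions of P over (Ω, 0) such that h^{(i+1)} is the (defined) lift of h^{(i)} for every 0 ≤ i ≤ q − 2, then the lift h^{(q)} of h^{(q−1)} is defined and is θ/2-regular. -/

import Mathlib

/-- The unimodal map `f_{c,ℓ₋,ℓ₊}(x) = |x|^{ℓ₋} + c` for `x ≤ 0` and `|x|^{ℓ₊} + c` for `x ≥ 0`. -/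
noncomputable def fml (lm lp c : ℝ) (x : ℝ) : ℝ :=
  if x ≤ 0 then |x| ^ lm + c else |x| ^ lp + c

/-- The forward orbit `P = {f^n(0) : n ≥ 0}` of the critical point. -/
def orbitSet (lm lp c : ℝ) : Set ℝ := {x | ∃ n : ℕ, (fml lm lp c)^[n] 0 = x}

/-- The unoriented angle `∠aob ∈ [0, π]` at the vertex `o`. -/
noncomputable def ang (a o b : ℂ) : ℝ := |Complex.arg ((b - o) / (a - o))|

/-- `D_θ = {z ∈ ℂ ∖ {0, 1} : ∠0z1 > π − θ}`. -/
def Dsec (θ : ℝ) : Set ℂ := {z | z ≠ 0 ∧ z ≠ 1 ∧ Real.pi - θ < ang 0 z 1}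

/-- The sector `S_θ = {r·e^{it} : r > 0, |t| < θ}`. -/
def Ssec (θ : ℝ) : Set ℂ := {z | z ≠ 0 ∧ |Complex.arg z| < θ}

/-- A holomorphic motion of `P ⊆ ℝ` over the pointed domain `(Ω, 0)`:
a family of injections `h_λ : P → ℂ`, holomorphic in `λ`, with `h_0 = id`. -/
def IsHoloMotion (P : Set ℝ) (Ω : Set ℂ) (h : ℂ → ℝ → ℂ) : Prop :=
  IsOpen Ω ∧ IsConnected Ω ∧ (0 : ℂ) ∈ Ω ∧
  (∀ x ∈ P, h 0 x = (x : ℂ)) ∧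
  (∀ l ∈ Ω, Set.InjOn (h l) P) ∧
  (∀ x ∈ P, DifferentiableOn ℂ (fun l => h l x) Ω)

/-- `θ`-regularity of a holomorphic motion of `P` (with `ℓ = min(ℓ₋, ℓ₊)`). -/
def ThetaRegular (ℓ θ : ℝ) (P : Set ℝ) (Ω : Set ℂ) (h : ℂ → ℝ → ℂ) : Prop :=
  ∀ l ∈ Ω,
    (∀ a ∈ P, 0 < a → h l a ∈ Ssec (4 * θ / ℓ)) ∧
    (∀ a ∈ P, a < 0 → -h l a ∈ Ssec (4 * θ / ℓ)) ∧
    (∀ a ∈ P, ∀ b ∈ P, |b| < |a| → 0 < |b| → 0 < a * b → h l b / h l a ∈ Dsec θ)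

/-- The slit `(−∞, 0] ⊆ ℂ`. -/
def slitRay : Set ℂ := {z | z.im = 0 ∧ z.re ≤ 0}

/-- The lift of a holomorphic motion: `h̃_λ(0) = 0`,
`h̃_λ(a) = (h_λ(f(a)) − h_λ(f(0)))^{1/ℓ₊}` for `a > 0` and
`h̃_λ(a) = −(h_λ(f(a)) − h_λ(f(0)))^{1/ℓ₋}` for `a < 0` (principal branch powers). -/
noncomputable def motionLift (lm lp c : ℝ) (h : ℂ → ℝ → ℂ) : ℂ → ℝ → ℂ :=
  fun l a =>
    if a = 0 then 0
    else if 0 < a then (h l (fml lm lp c a) - h l (fml lm lp c 0)) ^ (((1 : ℝ) / lp : ℝ) : ℂ)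
    else -((h l (fml lm lp c a) - h l (fml lm lp c 0)) ^ (((1 : ℝ) / lm : ℝ) : ℂ))

/-- The lift is defined: all the bases avoid `(−∞, 0]` and the lift is again
a holomorphic motion of `P` over `(Ω, 0)`. -/
def LiftDefined (lm lp c : ℝ) (P : Set ℝ) (Ω : Set ℂ) (h : ℂ → ℝ → ℂ) : Prop :=
  (∀ l ∈ Ω, ∀ a ∈ P, a ≠ 0 →
    h l (fml lm lp c a) - h l (fml lm lp c 0) ∉ slitRay) ∧
  IsHoloMotion P Ω (motionLift lm lp c h)



lemma aux_arg_le {z : ℂ} (hz : 0 < z.re) : |Complex.arg z| ≤ |z.im| / z.re := by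
  have h1 : |Complex.arg z| < Real.pi / 2 := Complex.abs_arg_lt_pi_div_two_iff.2 (Or.inl hz)
  have h2 := Real.le_tan (abs_nonneg (Complex.arg z)) h1
  have h3 : Real.tan |Complex.arg z| ≤ |z.im| / z.re := by
    have := Complex.tan_arg z
    rcases abs_cases (Complex.arg z) with ⟨h, _⟩ | ⟨h, _⟩
    · rw [h, this]; gcongr; exact le_abs_self _
    · rw [h, Real.tan_neg, this, ← neg_div]; gcongr; exact neg_le_abs _
  exact h2.trans h3

lemma aux_argdiff {A B : ℂ} (hA : 0 < A.re) (hB : 0 < B.re)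
    (h : 0 < A.re * B.re + A.im * B.im) :
    |A.arg - B.arg| ≤ |A.im * B.re - A.re * B.im| / (A.re * B.re + A.im * B.im) := by
  have h1 := abs_lt.1 (Complex.abs_arg_lt_pi_div_two_iff.2 (Or.inl hA))
  have h2 := abs_lt.1 (Complex.abs_arg_lt_pi_div_two_iff.2 (Or.inl hB))
  have hA0 : A ≠ 0 := by rintro rfl; simp at hA
  have hB0 : B ≠ 0 := by rintro rfl; simp at hB
  have hc : ((starRingEnd ℂ) B).arg = - B.arg := by
    rw [Complex.arg_conj, if_neg]; intro h; rw [h] at h2; linarith [Real.pi_pos]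
  have h3 : (A * (starRingEnd ℂ) B).arg = A.arg - B.arg := by
    rw [Complex.arg_mul hA0 (by simpa using hB0), hc]
    · ring
    · rw [hc]; constructor <;> linarith [h1.1, h1.2, h2.1, h2.2]
  have h4 := @aux_arg_le (A * (starRingEnd ℂ) B) (by simpa using h)
  rw [h3] at h4
  convert h4 using 2
  · congr 1; simp; ring
  · simp

lemma aux_log_ratio {a b : ℝ} (hb : 0 < b) (hab : b ≤ a) :
    (a ^ 2 - b ^ 2) / (a * (a + b)) ≤ Real.log a - Real.log b := by
  have ha : 0 < a := by linarith
  rw [← Real.log_div ha.ne' hb.ne']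
  have := Real.one_sub_inv_le_log_of_pos (div_pos ha hb)
  refine le_trans (le_of_eq ?_) this
  field_simp; ring

lemma aux_logmono {A B : ℂ} (hB : B ≠ 0) (h : Complex.normSq B ≤ Complex.normSq A) :
    (Complex.log B).re ≤ (Complex.log A).re := by
  rw [Complex.log_re, Complex.log_re]
  apply Real.log_le_log (norm_pos_iff.2 hB)
  rw [Complex.normSq_eq_norm_sq, Complex.normSq_eq_norm_sq] at h
  exact (sq_le_sq₀ (norm_nonneg _) (norm_nonneg _)).1 h

lemma aux_cosdiff {x y e : ℝ} (hx : |x| ≤ e) (hy : |y| ≤ e) :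
    |Real.cos x - Real.cos y| ≤ e * |x - y| := by
  rw [Real.cos_sub_cos]
  have h1 : |Real.sin ((x + y) / 2)| ≤ e := by
    refine (Real.abs_sin_le_abs).trans ?_
    rw [abs_le] at *; constructor <;> linarith [hx.1, hx.2, hy.1, hy.2]
  have h2 : |Real.sin ((x - y) / 2)| ≤ |x - y| / 2 := by
    refine (Real.abs_sin_le_abs).trans ?_
    rw [abs_div]; simp
  rw [abs_mul, abs_mul, abs_neg, abs_two]
  have := mul_le_mul h1 h2 (abs_nonneg _) ((abs_nonneg _).trans h1)
  linarith

lemma aux_sindiff (x y : ℝ) : |Real.sin x - Real.sin y| ≤ |x - y| := by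
  exact Real.abs_sin_sub_sin_le x y

lemma aux_cos_ge {x e : ℝ} (hx : |x| ≤ e) : 1 - e ^ 2 / 2 ≤ Real.cos x := by
  have := Real.one_sub_sq_div_two_le_cos (x := x)
  have h2 : x ^ 2 ≤ e ^ 2 := by rw [← sq_abs x]; exact pow_le_pow_left₀ (abs_nonneg _) hx 2
  linarith

lemma aux_E_le {u : ℝ} : u ≤ (1 + u) * (1 - Real.exp (-u)) := by
  have h1 := Real.add_one_le_exp u
  have h2 : Real.exp (-u) * Real.exp u = 1 := by rw [← Real.exp_add]; simp
  have h3 := Real.exp_pos (-u)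
  nlinarith


/-- `1 + R e^{iδ}` -/
noncomputable def pY (R d : ℝ) : ℂ := ⟨1 + R * Real.cos d, R * Real.sin d⟩

lemma pY_eq (z : ℂ) : 1 + Complex.exp z = pY (Real.exp z.re) z.im := by
  apply Complex.ext <;> simp [pY, Complex.exp_re, Complex.exp_im]

lemma pY_normSq (R d : ℝ) : Complex.normSq (pY R d) = 1 + R ^ 2 + 2 * R * Real.cos d := by
  simp only [pY, Complex.normSq_mk]; nlinarith [Real.sin_sq_add_cos_sq d]

lemma pY_re {R d : ℝ} (hR : 0 < R) (hd : |d| ≤ 1) : 1 < (pY R d).re := by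
  have := aux_cos_ge hd
  simp only [pY]; nlinarith

lemma pY_ne {R d : ℝ} (hR : 0 < R) (hd : |d| ≤ 1) : pY R d ≠ 0 := by
  intro h; have := pY_re hR hd; rw [h] at this; simp at this; linarith

lemma pY_arg {R d : ℝ} (hR : 0 < R) (hd : |d| ≤ 1) : |(pY R d).arg| ≤ 2 * |d| := by
  have h1 := pY_re hR hd
  have hc := aux_cos_ge hd
  refine (aux_arg_le (by linarith)).trans ?_
  rw [div_le_iff₀ (by linarith)]
  simp only [pY, abs_mul, abs_of_pos hR]
  have h2 := Real.abs_sin_le_abs (x := d)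
  have h3 := abs_nonneg d
  have h4 : R * |Real.sin d| ≤ R * |d| := by gcongr
  have h5 : R * |d| * 1 ≤ R * |d| * (2 * Real.cos d) := by gcongr; linarith
  nlinarith

lemma pY_cross {R d : ℝ} (hR : 0 < R) (hd : |d| ≤ 1) :
    |(pY R d).arg| ≤ 2 * |d| * (Complex.log (pY R d)).re := by
  have h1 := pY_re hR hd
  have hc := aux_cos_ge hd
  have hn : (pY R d).re ≤ ‖pY R d‖ := (Complex.abs_re_le_norm _).trans' (le_abs_self _)
  have h2 := Real.one_sub_inv_le_log_of_pos (show 0 < ‖pY R d‖ by linarith)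
  have h3 : (‖pY R d‖)⁻¹ ≤ ((pY R d).re)⁻¹ := by
    apply inv_anti₀ (by linarith) hn
  rw [Complex.log_re]
  refine (aux_arg_le (by linarith)).trans ?_
  have h4 : 2 * |d| * (1 - ((pY R d).re)⁻¹) ≤ 2 * |d| * Real.log ‖pY R d‖ := by
    gcongr; linarith
  refine le_trans ?_ h4
  rw [div_le_iff₀ (by linarith), mul_assoc, sub_mul, inv_mul_cancel₀ (by linarith)]
  simp only [pY, abs_mul, abs_of_pos hR]
  have h2 := Real.abs_sin_le_abs (x := d)
  have h4 : R * |Real.sin d| ≤ R * |d| := by gcongr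
  have h5 : R * |d| * 1 ≤ R * |d| * (2 * Real.cos d) := by gcongr; linarith
  nlinarith

lemma pY_normSq_diff {T S dT dS e th : ℝ} (hS : 0 < S) (hST : S ≤ T) (hT : |dT| ≤ e)
    (hdS : |dS| ≤ e) (he : e ≤ 1 / 10) (hth0 : 0 ≤ th) (hth : th ≤ 1 / 100)
    (hd : T * |dT - dS| ≤ 2 * th * (T - S)) :
    (T - S) * (T + S + 2 * (1 - e)) ≤
      Complex.normSq (pY T dT) - Complex.normSq (pY S dS) := by
  have he0 : 0 ≤ e := (abs_nonneg _).trans hT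
  rw [pY_normSq, pY_normSq]
  have h1 := aux_cosdiff hT hdS
  have h2 := aux_cos_ge hT
  have h3 : S * |Real.cos dT - Real.cos dS| ≤ e * (2 * th * (T - S)) := by
    calc S * |Real.cos dT - Real.cos dS| ≤ T * (e * |dT - dS|) := by gcongr; linarith
      _ = e * (T * |dT - dS|) := by ring
      _ ≤ _ := by gcongr
  have h4 : - (S * |Real.cos dT - Real.cos dS|) ≤ S * (Real.cos dT - Real.cos dS) := by
    have := neg_abs_le (Real.cos dT - Real.cos dS); nlinarith
  have h5 : (T - S) * (1 - e ^ 2 / 2) ≤ (T - S) * Real.cos dT :=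
    mul_le_mul_of_nonneg_left h2 (by linarith)
  have h6 : (T - S) * (1 - e) ≤ (T - S) * (1 - e ^ 2 / 2 - 2 * th * e) :=
    mul_le_mul_of_nonneg_left (by nlinarith) (by linarith)
  nlinarith

lemma pY_mono {T S dT dS e th : ℝ} (hS : 0 < S) (hST : S ≤ T) (hT : |dT| ≤ e)
    (hdS : |dS| ≤ e) (he : e ≤ 1 / 10) (hth0 : 0 ≤ th) (hth : th ≤ 1 / 100)
    (hd : T * |dT - dS| ≤ 2 * th * (T - S)) :
    (1 - e) * (T - S) / (1 + T) ≤ (Complex.log (pY T dT)).re - (Complex.log (pY S dS)).re := by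
  have h1 := pY_normSq_diff hS hST hT hdS he hth0 hth hd
  have hnS : 0 < ‖pY S dS‖ := norm_pos_iff.2 (pY_ne hS (by linarith))
  rw [Complex.normSq_eq_norm_sq, Complex.normSq_eq_norm_sq] at h1
  rw [Complex.log_re, Complex.log_re]
  have hn : ∀ {R d : ℝ}, 0 < R → ‖pY R d‖ ≤ 1 + R := by
    intro R d hR
    rw [← sq_le_sq₀ (norm_nonneg _) (by positivity), ← Complex.normSq_eq_norm_sq, pY_normSq]
    nlinarith [Real.cos_le_one d]
  have h0 : 0 ≤ (T - S) * (T + S + 2 * (1 - e)) := by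
    apply mul_nonneg <;> linarith
  have hle : ‖pY S dS‖ ≤ ‖pY T dT‖ := by
    rw [← sq_le_sq₀ (norm_nonneg _) (norm_nonneg _)]; linarith
  refine le_trans ?_ (aux_log_ratio hnS hle)
  have hnT := hn (R := T) (d := dT) (by linarith)
  have hnS' := hn (R := S) (d := dS) (by linarith)
  calc (1 - e) * (T - S) / (1 + T)
      ≤ (T - S) * (T + S + 2 * (1 - e)) / ((1 + T) * ((1 + T) + (1 + S))) := by
        rw [div_le_div_iff₀ (by linarith) (by nlinarith)]
        have : 0 ≤ (T - S) * (1 + T) := mul_nonneg (by linarith) (by linarith)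
        have he0 : 0 ≤ e := (abs_nonneg _).trans hT
        have : 0 ≤ ((T - S) * (1 + T)) * (e * (T + S)) := by
          apply mul_nonneg this; apply mul_nonneg he0; linarith
        nlinarith
    _ ≤ _ := by
        apply div_le_div₀ (by linarith) h1
        · apply mul_pos <;> linarith
        · gcongr; linarith

lemma pY_argdiff {S T A B dA dB e : ℝ} (hS : 0 < S) (hA : S ≤ A) (hAT : A ≤ T) (hB : S ≤ B)
    (hBT : B ≤ T) (hdA : |dA| ≤ e) (hdB : |dB| ≤ e) (he : e ≤ 1 / 10) :
    |(pY A dA).arg - (pY B dB).arg| ≤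
      (T * |dA - dB| + (T - S) * e) / ((1 + T) * (1 - e)) := by
  have he0 : 0 ≤ e := (abs_nonneg _).trans hdA
  have hA0 : 0 < A := by linarith
  have hB0 : 0 < B := by linarith
  have hcA := aux_cos_ge hdA
  have hcB := aux_cos_ge hdB
  have hcAB : 1 - (2 * e) ^ 2 / 2 ≤ Real.cos (dA - dB) := by
    apply aux_cos_ge
    refine (abs_sub _ _).trans (by linarith)
  have hRe : (1 - e) * ((1 + A) * (1 + B)) ≤
      (pY A dA).re * (pY B dB).re + (pY A dA).im * (pY B dB).im := by
    have : (pY A dA).re * (pY B dB).re + (pY A dA).im * (pY B dB).im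
      = 1 + A * Real.cos dA + B * Real.cos dB + A * B * Real.cos (dA - dB) := by
      simp only [pY, Real.cos_sub]; ring
    rw [this]
    have e1 : A * (1 - e) ≤ A * Real.cos dA := by gcongr; nlinarith
    have e2 : B * (1 - e) ≤ B * Real.cos dB := by gcongr; nlinarith
    have e3 : A * B * (1 - e) ≤ A * B * Real.cos (dA - dB) := by gcongr; nlinarith
    nlinarith
  have hRe0 : 0 < (1 - e) * ((1 + A) * (1 + B)) := by
    apply mul_pos; linarith; positivity
  have hIm : |(pY A dA).im * (pY B dB).re - (pY A dA).re * (pY B dB).im| ≤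
      A * (1 + B) * |dA - dB| + |A - B| * e := by
    have : (pY A dA).im * (pY B dB).re - (pY A dA).re * (pY B dB).im =
      A * (Real.sin dA - Real.sin dB) + A * B * Real.sin (dA - dB) + (A - B) * Real.sin dB := by
      simp only [pY, Real.sin_sub]; ring
    rw [this]
    refine (abs_add_le _ _).trans (add_le_add ((abs_add_le _ _).trans ?_) ?_)
    · rw [abs_mul, abs_mul, abs_mul, abs_of_pos hA0, abs_of_pos hB0]
      have e1 := Real.abs_sin_sub_sin_le dA dB
      have e2 := Real.abs_sin_le_abs (x := dA - dB)
      calc _ ≤ A * |dA - dB| + A * B * |dA - dB| := by gcongr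
        _ = _ := by ring
    · rw [abs_mul]
      have e2 := (Real.abs_sin_le_abs (x := dB)).trans hdB
      gcongr
  refine (aux_argdiff ((pY_re hA0 (by linarith)).trans' one_pos)
    ((pY_re hB0 (by linarith)).trans' one_pos) (by linarith)).trans ?_
  have hTS : 0 ≤ (T - S) * e := mul_nonneg (by linarith) he0
  calc _ ≤ (A * (1 + B) * |dA - dB| + |A - B| * e) / ((1 - e) * ((1 + A) * (1 + B))) := by
        apply div_le_div₀ _ hIm hRe0 hRe
        have := abs_nonneg (dA - dB)
        positivity
    _ = (A / (1 + A) * |dA - dB| + |A - B| / ((1 + A) * (1 + B)) * e) / (1 - e) := by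
        have : 1 - e ≠ 0 := by linarith
        field_simp
    _ ≤ (T / (1 + T) * |dA - dB| + (T - S) * e / (1 + T)) / (1 - e) := by
        have h1 : A / (1 + A) ≤ T / (1 + T) := by
          rw [div_le_div_iff₀ (by linarith) (by linarith)]; nlinarith
        have h2 : |A - B| / ((1 + A) * (1 + B)) ≤ (T - S) / (1 + T) := by
          have k1 : |A - B| / ((1 + A) * (1 + B)) = |1 / (1 + B) - 1 / (1 + A)| := by
            rw [← abs_of_pos (show 0 < (1 + A) * (1 + B) by positivity), ← abs_div]
            congr 1; field_simp; ring
          have k2 : ∀ X, S ≤ X → X ≤ T → 1 / (1 + T) ≤ 1 / (1 + X) ∧ 1 / (1 + X) ≤ 1 / (1 + S) := by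
            intro X hX hX'
            constructor <;> apply one_div_le_one_div_of_le <;> linarith
          have k3 : 1 / (1 + S) - 1 / (1 + T) ≤ (T - S) / (1 + T) := by
            rw [div_sub_div _ _ (by linarith) (by linarith), div_le_div_iff₀ (by nlinarith) (by linarith)]
            have : 0 ≤ (T - S) * (1 + T) := mul_nonneg (by linarith) (by linarith)
            nlinarith
          rw [k1, abs_le]
          have := k2 A hA hAT
          have := k2 B hB hBT
          constructor <;> linarith
        have h3 : (T - S) / (1 + T) * e = (T - S) * e / (1 + T) := by ring
        rw [← h3]
        gcongr
        linarith
    _ = _ := by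
        have : 1 - e ≠ 0 := by linarith
        have : 1 + T ≠ 0 := by linarith
        field_simp

lemma pY_step {S T A B dT dS dA dB e th : ℝ} (hS : 0 < S) (hA : S ≤ A) (hAT : A ≤ T) (hB : S ≤ B)
    (hBT : B ≤ T) (hdA : |dA| ≤ e) (hdB : |dB| ≤ e) (hdT : |dT| ≤ e) (hdS : |dS| ≤ e)
    (he : e ≤ 1 / 10) (hth0 : 0 ≤ th) (hth : th ≤ 1 / 100)
    (hd : T * |dT - dS| ≤ 2 * th * (T - S)) :
    |(pY A dA).arg - (pY B dB).arg| * (1 - S / T) ≤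
      (1 + 3 * e) * (|dA - dB| + e * (1 - S / T)) *
        ((Complex.log (pY T dT)).re - (Complex.log (pY S dS)).re) := by
  have he0 : 0 ≤ e := (abs_nonneg _).trans hdA
  have hT : 0 < T := by linarith
  have hST : S / T ≤ 1 := by rw [div_le_one hT]; linarith
  have h1 := pY_argdiff hS hA hAT hB hBT hdA hdB he
  have h2 := pY_mono hS (hA.trans hAT) hdT hdS he hth0 hth hd
  set X := |dA - dB| + e * (1 - S / T) with hX
  have hX0 : 0 ≤ X := by
    have := abs_nonneg (dA - dB)
    have : 0 ≤ e * (1 - S / T) := mul_nonneg he0 (by linarith)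
    linarith
  set E := 1 - S / T with hE
  have hE0 : 0 ≤ E := by linarith
  have hTE : T - S = T * E := by rw [hE]; field_simp
  have h3 : (T * |dA - dB| + (T - S) * e) / ((1 + T) * (1 - e)) = T / (1 + T) * X / (1 - e) := by
    have : 1 - e ≠ 0 := by linarith
    rw [hTE, hX]; field_simp
  have h4 : (1 - e) * (T - S) / (1 + T) = T / (1 + T) * (1 - e) * E := by
    rw [hTE]; ring
  rw [h3] at h1
  rw [h4] at h2
  have h5 : 1 / (1 - e) ≤ (1 + 3 * e) * (1 - e) := by
    rw [div_le_iff₀ (by linarith)]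
    nlinarith [mul_nonneg he0 (sub_nonneg.2 he), pow_nonneg he0 3]
  calc _ ≤ T / (1 + T) * X / (1 - e) * E := by gcongr
    _ = (T / (1 + T) * X * E) * (1 / (1 - e)) := by ring
    _ ≤ (T / (1 + T) * X * E) * ((1 + 3 * e) * (1 - e)) := by gcongr
    _ = (1 + 3 * e) * X * (T / (1 + T) * (1 - e) * E) := by ring
    _ ≤ _ := by gcongr


/-- `1 - r e^{iδ}` -/
noncomputable def nY (r d : ℝ) : ℂ := ⟨1 - r * Real.cos d, - (r * Real.sin d)⟩

lemma nY_eq (z : ℂ) : 1 - Complex.exp z = nY (Real.exp z.re) z.im := by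
  apply Complex.ext <;> simp [nY, Complex.exp_re, Complex.exp_im]

lemma nY_normSq (r d : ℝ) : Complex.normSq (nY r d) = (1 - r) ^ 2 + 2 * r * (1 - Real.cos d) := by
  simp only [nY, Complex.normSq_mk]
  linear_combination (r ^ 2) * Real.sin_sq_add_cos_sq d

lemma nY_re {r d : ℝ} (hr : 0 < r) : 1 - r ≤ (nY r d).re := by
  have := Real.cos_le_one d
  simp only [nY]; nlinarith

lemma nY_ne {r d : ℝ} (hr : 0 < r) (hr1 : r < 1) : nY r d ≠ 0 := by
  intro h; have := nY_re (d := d) hr; rw [h] at this; simp at this; linarith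

lemma nY_arg {r d : ℝ} (hr : 0 < r) (hr1 : r < 1) : |(nY r d).arg| ≤ r * |d| / (1 - r) := by
  have h1 := nY_re (d := d) hr
  refine (aux_arg_le (by linarith)).trans ?_
  apply div_le_div₀ (by positivity) _ (by linarith) h1
  simp only [nY, abs_neg, abs_mul, abs_of_pos hr]
  have h2 := Real.abs_sin_le_abs (x := d)
  gcongr

lemma nY_arg' {r d th : ℝ} (hr : 0 < r) (hr1 : r < 1) (hd : |d| ≤ 2 * th * (1 - r)) :
    |(nY r d).arg| ≤ 2 * th := by
  refine (nY_arg hr hr1).trans ?_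
  rw [div_le_iff₀ (by linarith)]
  nlinarith [abs_nonneg d]

lemma nY_normSq_le {r d th : ℝ} (hr : 0 < r) (hth0 : 0 ≤ th)
    (hth : th ≤ 1 / 100) (hd : |d| ≤ 2 * th * (1 - r)) :
    Complex.normSq (nY r d) ≤ (1 - r) ^ 2 * (1 + r / 100) := by
  rw [nY_normSq]
  have h1 := Real.one_sub_sq_div_two_le_cos (x := d)
  have h2 : d ^ 2 ≤ (2 * th * (1 - r)) ^ 2 := by
    rw [← sq_abs d]; exact pow_le_pow_left₀ (abs_nonneg _) hd 2
  have h3 : (2 * th * (1 - r)) ^ 2 ≤ (1 - r) ^ 2 / 100 := by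
    have : th ^ 2 ≤ 1 / 10000 := by nlinarith
    nlinarith [sq_nonneg (1 - r)]
  have h4 : 2 * r * (1 - Real.cos d) ≤ r * d ^ 2 := by nlinarith
  nlinarith

lemma nY_logre {r d th : ℝ} (hr : 0 < r) (hr1 : r < 1) (hth0 : 0 ≤ th)
    (hth : th ≤ 1 / 100) (hd : |d| ≤ 2 * th * (1 - r)) :
    (Complex.log (nY r d)).re ≤ Real.log (1 - r) / 2 := by
  have h1 := nY_normSq_le hr hth0 hth hd
  have h2 : (1 - r) ^ 2 * (1 + r / 100) ≤ 1 - r := by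
    have : (1 - r) * (1 + r / 100) ≤ 1 := by nlinarith
    nlinarith
  rw [Complex.log_re]
  have h3 : ‖nY r d‖ ^ 2 ≤ 1 - r := by rw [← Complex.normSq_eq_norm_sq]; linarith
  have h4 : 0 < ‖nY r d‖ := norm_pos_iff.2 (nY_ne hr hr1)
  have h5 := Real.log_le_log (by positivity) h3
  rw [Real.log_pow] at h5
  push_cast at h5
  linarith

lemma nY_cross {r d th k ell : ℝ} (hr : 0 < r) (hr1 : r < 1) (hth0 : 0 ≤ th)
    (hth : th ≤ 1 / 100) (hd : |d| ≤ 2 * th * (1 - r)) (hk : 0 < k)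
    (hell : 16 / (k * Real.exp (-(4 / k))) ≤ ell) (hd' : |d| ≤ 8 * th / ell) :
    |(nY r d).arg| ≤ k * th * (-(Complex.log (nY r d)).re) := by
  have h1 := nY_logre hr hr1 hth0 hth hd
  have hs := Real.exp_pos (-(4 / k))
  have hell0 : 0 < ell := lt_of_lt_of_le (by positivity) hell
  suffices h : |(nY r d).arg| ≤ (k / 2) * th * (-Real.log (1 - r)) by
    refine h.trans ?_
    have : k * th * (-Real.log (1 - r) / 2) ≤ k * th * (-(Complex.log (nY r d)).re) := by
      gcongr; linarith
    linarith
  by_cases hc : Real.exp (-(4 / k)) ≤ 1 - r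
  · have h2 : r ≤ -Real.log (1 - r) := by
      have := Real.log_le_sub_one_of_pos (show 0 < 1 - r by linarith); linarith
    refine (nY_arg hr hr1).trans ?_
    have h3 : |d| / (1 - r) ≤ (k / 2) * th := by
      rw [div_le_iff₀ (by linarith)]
      refine hd'.trans ?_
      rw [div_le_iff₀ hell0]
      rw [div_le_iff₀ (by positivity)] at hell
      have : ell * (k * Real.exp (-(4 / k))) ≤ ell * (k * (1 - r)) := by gcongr
      have h5 : 16 ≤ ell * (k * (1 - r)) := by linarith
      nlinarith
    calc r * |d| / (1 - r) = |d| / (1 - r) * r := by ring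
      _ ≤ (k / 2) * th * (-Real.log (1 - r)) := by gcongr
  · have h2 : Real.log (1 - r) ≤ -(4 / k) := by
      rw [Real.log_le_iff_le_exp (by linarith)]; linarith
    refine (nY_arg' hr hr1 hd).trans ?_
    calc 2 * th = k / 2 * th * (4 / k) := by field_simp; ring
      _ ≤ _ := by gcongr; linarith

lemma nY_normSq_diff {n f dn df th : ℝ} (hf : 0 < f) (hfn : f ≤ n) (hn : n < 1)
    (hth0 : 0 ≤ th) (hth : th ≤ 1 / 100)
    (hdn : |dn| ≤ 2 * th * (1 - n)) (hdf : |df| ≤ 2 * th * (1 - f))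
    (hd : n * |dn - df| ≤ 2 * th * (n - f)) :
    (n - f) * (1 - f) / 2 ≤ Complex.normSq (nY f df) - Complex.normSq (nY n dn) := by
  rw [nY_normSq, nY_normSq]
  have hdn' : |dn| ≤ 2 * th * (1 - f) := hdn.trans (by gcongr)
  have h1 := aux_cosdiff hdn' hdf
  have h2 := aux_cos_ge hdn'
  have h3 : f * |Real.cos dn - Real.cos df| ≤ (2 * th * (1 - f)) * (2 * th * (n - f)) := by
    calc f * |Real.cos dn - Real.cos df| ≤ n * ((2 * th * (1 - f)) * |dn - df|) := by
          gcongr; linarith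
      _ = (2 * th * (1 - f)) * (n * |dn - df|) := by ring
      _ ≤ _ := mul_le_mul_of_nonneg_left hd (mul_nonneg (by linarith) (by linarith))
  have h4 : - (f * |Real.cos dn - Real.cos df|) ≤ f * (Real.cos dn - Real.cos df) := by
    have := neg_abs_le (Real.cos dn - Real.cos df); nlinarith
  have h5 : (n - f) * (1 - Real.cos dn) ≤ (n - f) * ((1 - f) * (1 / 100)) := by
    apply mul_le_mul_of_nonneg_left _ (by linarith)
    have : (2 * th * (1 - f)) ^ 2 / 2 ≤ (1 - f) * (1 / 100) := by
      have a1 : th ^ 2 ≤ 1 / 10000 := by nlinarith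
      have a2 : (1 - f) ^ 2 ≤ 1 - f := by nlinarith
      have a3 : th ^ 2 * (1 - f) ^ 2 ≤ 1 / 10000 * (1 - f) := by gcongr
      nlinarith
    linarith
  have hp : 0 ≤ (n - f) * (1 - f) := mul_nonneg (by linarith) (by linarith)
  have h6 : (2 * th * (1 - f)) * (2 * th * (n - f)) ≤ (n - f) * (1 - f) / 100 := by
    have a1 : th ^ 2 ≤ 1 / 10000 := by nlinarith
    nlinarith
  have h7 : 0 ≤ (n - f) * (1 - n) := mul_nonneg (by linarith) (by linarith)
  nlinarith

lemma nY_norm_ge {r d : ℝ} (hr : 0 < r) : 1 - r ≤ ‖nY r d‖ :=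
  (nY_re hr).trans ((le_abs_self _).trans (Complex.abs_re_le_norm _))

lemma nY_mono {n f dn df th : ℝ} (hf : 0 < f) (hfn : f ≤ n) (hn : n < 1)
    (hth0 : 0 ≤ th) (hth : th ≤ 1 / 100)
    (hdn : |dn| ≤ 2 * th * (1 - n)) (hdf : |df| ≤ 2 * th * (1 - f))
    (hd : n * |dn - df| ≤ 2 * th * (n - f)) :
    (n - f) / (1 - f) / 8 ≤ (Complex.log (nY f df)).re - (Complex.log (nY n dn)).re := by
  have h1 := nY_normSq_diff hf hfn hn hth0 hth hdn hdf hd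
  have h2 := nY_normSq_le hf hth0 hth hdf
  have hnn : 0 < ‖nY n dn‖ := norm_pos_iff.2 (nY_ne (by linarith) hn)
  have hp : 0 ≤ (n - f) * (1 - f) := mul_nonneg (by linarith) (by linarith)
  rw [Complex.normSq_eq_norm_sq, Complex.normSq_eq_norm_sq] at h1
  rw [Complex.normSq_eq_norm_sq] at h2
  rw [Complex.log_re, Complex.log_re]
  have hle : ‖nY n dn‖ ≤ ‖nY f df‖ := by
    rw [← sq_le_sq₀ (norm_nonneg _) (norm_nonneg _)]; linarith
  refine le_trans ?_ (aux_log_ratio hnn hle)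
  have h3 : ‖nY f df‖ * (‖nY f df‖ + ‖nY n dn‖) ≤ 4 * (1 - f) ^ 2 := by
    nlinarith [sq_nonneg (1 - f)]
  have hf1 : 0 < 1 - f := by linarith
  calc (n - f) / (1 - f) / 8 = ((n - f) * (1 - f) / 2) / (4 * (1 - f) ^ 2) := by
        field_simp; ring
    _ ≤ _ := by
        apply div_le_div₀ (by linarith) h1 _ h3
        apply mul_pos <;> linarith

lemma nY_argdiff {n f A B dA dB th e : ℝ} (hf : 0 < f) (hA : f ≤ A) (hAn : A ≤ n) (hB : f ≤ B)
    (hBn : B ≤ n) (hn : n < 1) (hth0 : 0 ≤ th) (hth : th ≤ 1 / 100)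
    (hdA : |dA| ≤ 2 * th * (1 - A)) (hdB : |dB| ≤ 2 * th * (1 - B)) (he : 0 ≤ e)
    (h1 : |dB| ≤ e * (1 - f)) (h2 : n * |dA - dB| ≤ e * (n - f)) :
    |(nY A dA).arg - (nY B dB).arg| ≤ 6 * e * ((n - f) * (1 - f)) / (1 - n) ^ 2 := by
  have hA0 : 0 < A := by linarith
  have hB0 : 0 < B := by linarith
  have hdA1 : |dA| ≤ 1 / 10 := by nlinarith
  have hdB1 : |dB| ≤ 1 / 10 := by nlinarith
  have hRe : (1 - n) ^ 2 / 2 ≤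
      (nY A dA).re * (nY B dB).re + (nY A dA).im * (nY B dB).im := by
    have e1 := nY_re (d := dA) hA0
    have e2 := nY_re (d := dB) hB0
    have i1 : |(nY A dA).im| ≤ (1 - A) / 10 := by
      simp only [nY, abs_neg, abs_mul, abs_of_pos hA0]
      have := Real.abs_sin_le_abs (x := dA)
      have : A * |Real.sin dA| ≤ 1 * (2 * (1 / 100) * (1 - A)) := by
        apply mul_le_mul (by linarith) (this.trans (hdA.trans _)) (abs_nonneg _) (by norm_num)
        gcongr; linarith
      linarith
    have i2 : |(nY B dB).im| ≤ (1 - B) / 10 := by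
      simp only [nY, abs_neg, abs_mul, abs_of_pos hB0]
      have := Real.abs_sin_le_abs (x := dB)
      have : B * |Real.sin dB| ≤ 1 * (2 * (1 / 100) * (1 - B)) := by
        apply mul_le_mul (by linarith) (this.trans (hdB.trans _)) (abs_nonneg _) (by norm_num)
        gcongr; linarith
      linarith
    have e3 : (1 - A) * (1 - B) ≤ (nY A dA).re * (nY B dB).re := by
      apply mul_le_mul e1 e2 <;> linarith
    have i3 : |(nY A dA).im * (nY B dB).im| ≤ (1 - A) / 10 * ((1 - B) / 10) := by
      rw [abs_mul]; apply mul_le_mul i1 i2 (abs_nonneg _); linarith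
    have := neg_abs_le ((nY A dA).im * (nY B dB).im)
    have e4 : (1 - n) * (1 - n) ≤ (1 - A) * (1 - B) := by
      apply mul_le_mul <;> linarith
    nlinarith
  have hn1 : 0 < 1 - n := by linarith
  have hRe0 : 0 < (1 - n) ^ 2 / 2 := by positivity
  have hIm : |(nY A dA).im * (nY B dB).re - (nY A dA).re * (nY B dB).im| ≤
      3 * e * ((n - f) * (1 - f)) := by
    have key : Real.sin dA - Real.sin dB - Real.sin (dA - dB) =
        - 4 * Real.sin ((dA - dB) / 2) * Real.sin (dA / 2) * Real.sin (dB / 2) := by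
      have hA2 : dA = 2 * (dA / 2) := by ring
      have hB2 : dB = 2 * (dB / 2) := by ring
      have hAB2 : dA - dB = 2 * (dA / 2 - dB / 2) := by ring
      have hAB3 : (dA - dB) / 2 = dA / 2 - dB / 2 := by ring
      rw [hAB3, hAB2]
      conv_lhs => rw [hA2, hB2]
      rw [Real.sin_two_mul, Real.sin_two_mul, Real.sin_two_mul]
      have : 2 * (dA / 2) / 2 - 2 * (dB / 2) / 2 = dA / 2 - dB / 2 := by ring
      rw [this, Real.sin_sub, Real.cos_sub]
      have s1 := Real.sin_sq_add_cos_sq (dA / 2)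
      have s2 := Real.sin_sq_add_cos_sq (dB / 2)
      have c1 : Real.cos (dA / 2) ^ 2 = 1 - Real.sin (dA / 2) ^ 2 := by linarith
      have c2 : Real.cos (dB / 2) ^ 2 = 1 - Real.sin (dB / 2) ^ 2 := by linarith
      generalize Real.sin (dA / 2) = sa at *
      generalize Real.sin (dB / 2) = sb at *
      generalize Real.cos (dA / 2) = ca at *
      generalize Real.cos (dB / 2) = cb at *
      have : sa ^ 2 = 1 - ca ^ 2 := by linarith
      linear_combination (2 * sb * cb) * s1 - (2 * sa * ca) * s2
    have : (nY A dA).im * (nY B dB).re - (nY A dA).re * (nY B dB).im =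
      - (A * (Real.sin dA - Real.sin dB - Real.sin (dA - dB)) + A * (1 - B) * Real.sin (dA - dB)
        + (A - B) * Real.sin dB) := by
      simp only [nY, Real.sin_sub]; ring
    rw [this, key, abs_neg]
    have hX := abs_nonneg (dA - dB)
    refine (abs_add_le _ _).trans ((add_le_add (abs_add_le _ _) le_rfl).trans ?_)
    have b1 : |A * (-4 * Real.sin ((dA - dB) / 2) * Real.sin (dA / 2) * Real.sin (dB / 2))| ≤
        A * |dA - dB| * (1 - f) := by
      have q1 : |Real.sin ((dA - dB) / 2)| ≤ |dA - dB| / 2 :=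
        Real.abs_sin_le_abs.trans (by rw [abs_div]; simp)
      have q2 : |Real.sin (dA / 2)| ≤ 1 := Real.abs_sin_le_one _
      have q3 : |Real.sin (dB / 2)| ≤ (1 - f) / 2 := by
        refine Real.abs_sin_le_abs.trans ?_
        rw [abs_div, abs_two]
        have : 2 * th * (1 - B) ≤ 1 * (1 - f) := by
          apply mul_le_mul <;> linarith
        linarith
      rw [abs_mul, abs_mul, abs_mul, abs_mul, abs_of_pos hA0]
      calc A * (|(-4 : ℝ)| * |Real.sin ((dA - dB) / 2)| * |Real.sin (dA / 2)| * |Real.sin (dB / 2)|)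
          ≤ A * (|(-4 : ℝ)| * (|dA - dB| / 2) * 1 * ((1 - f) / 2)) := by gcongr
        _ = _ := by norm_num; ring
    have b2 : |A * (1 - B) * Real.sin (dA - dB)| ≤ A * |dA - dB| * (1 - f) := by
      rw [abs_mul, abs_mul, abs_of_pos hA0, abs_of_pos (show 0 < 1 - B by linarith)]
      have := Real.abs_sin_le_abs (x := dA - dB)
      calc A * (1 - B) * |Real.sin (dA - dB)| ≤ A * (1 - f) * |dA - dB| := by
            gcongr; exact mul_nonneg hA0.le (by linarith)
        _ = _ := by ring
    have b3 : |(A - B) * Real.sin dB| ≤ (n - f) * (e * (1 - f)) := by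
      rw [abs_mul]
      have e3 : |A - B| ≤ n - f := by rw [abs_le]; constructor <;> linarith
      exact mul_le_mul e3 (Real.abs_sin_le_abs.trans h1) (abs_nonneg _) (by linarith)
    have b4 : A * |dA - dB| * (1 - f) ≤ e * (n - f) * (1 - f) := by
      have : A * |dA - dB| ≤ n * |dA - dB| := by gcongr
      exact mul_le_mul_of_nonneg_right (this.trans h2) (by linarith)
    linarith
  refine (aux_argdiff ((nY_re hA0).trans_lt' (by linarith))
    ((nY_re hB0).trans_lt' (by linarith)) (by linarith)).trans ?_
  calc _ ≤ 3 * e * ((n - f) * (1 - f)) / ((1 - n) ^ 2 / 2) := by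
        apply div_le_div₀ _ hIm hRe0 hRe
        exact (abs_nonneg _).trans hIm
    _ = _ := by field_simp; ring

lemma nY_step {n f A B dA dB dn df th e Bd : ℝ} (hf : 0 < f) (hA : f ≤ A) (hAn : A ≤ n)
    (hB : f ≤ B)
    (hBn : B ≤ n) (hn : n < 1) (hth0 : 0 ≤ th) (hth : th ≤ 1 / 100)
    (hdA : |dA| ≤ 2 * th * (1 - A)) (hdB : |dB| ≤ 2 * th * (1 - B)) (he : 0 ≤ e)
    (h1 : |dB| ≤ e * (1 - f)) (h2 : n * |dA - dB| ≤ e * (n - f))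
    (hdn : |dn| ≤ 2 * th * (1 - n)) (hdf : |df| ≤ 2 * th * (1 - f))
    (hd : n * |dn - df| ≤ 2 * th * (n - f))
    (hBd : (Complex.log (nY f df)).re - (Complex.log (nY n dn)).re ≤ Bd) :
    |(nY A dA).arg - (nY B dB).arg| ≤ 96 * e * Real.exp (2 * Bd) *
      ((Complex.log (nY f df)).re - (Complex.log (nY n dn)).re) := by
  have k1 := nY_argdiff hf hA hAn hB hBn hn hth0 hth hdA hdB he h1 h2
  have k2 := nY_mono hf (hA.trans hAn) hn hth0 hth hdn hdf hd
  set X := (Complex.log (nY f df)).re - (Complex.log (nY n dn)).re with hX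
  have hn0 : 0 < n := by linarith
  have hn1 : 0 < 1 - n := by linarith
  have hf1 : 0 < 1 - f := by linarith
  have k3 : (1 - f) ^ 2 ≤ 2 * (1 - n) ^ 2 * Real.exp (2 * Bd) := by
    have a1 : (1 - f) ≤ ‖nY f df‖ := nY_norm_ge hf
    have a2 := nY_normSq_le hn0 hth0 hth hdn
    rw [Complex.normSq_eq_norm_sq] at a2
    have a3 : ‖nY f df‖ = Real.exp X * ‖nY n dn‖ := by
      have p1 : 0 < ‖nY f df‖ := by linarith
      have p2 : 0 < ‖nY n dn‖ := norm_pos_iff.2 (nY_ne hn0 hn)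
      rw [hX, Complex.log_re, Complex.log_re, Real.exp_sub, Real.exp_log p1, Real.exp_log p2]
      field_simp
    have a4 : Real.exp X ^ 2 ≤ Real.exp (2 * Bd) := by
      rw [← Real.exp_nat_mul]; apply Real.exp_le_exp.2; push_cast; linarith
    calc (1 - f) ^ 2 ≤ ‖nY f df‖ ^ 2 := by gcongr
      _ = ‖nY n dn‖ ^ 2 * Real.exp X ^ 2 := by rw [a3]; ring
      _ ≤ (2 * (1 - n) ^ 2) * Real.exp (2 * Bd) := by
          gcongr
          refine a2.trans ?_
          nlinarith [sq_nonneg (1 - n)]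
  have hnf : 0 ≤ n - f := by linarith
  calc _ ≤ 6 * e * ((n - f) * (1 - f)) / (1 - n) ^ 2 := k1
    _ = 6 * e * ((n - f) / (1 - f)) * ((1 - f) ^ 2 / (1 - n) ^ 2) := by field_simp
    _ ≤ 6 * e * (8 * X) * (2 * Real.exp (2 * Bd)) := by
        have m1 : (n - f) / (1 - f) ≤ 8 * X := by linarith
        have m2 : (1 - f) ^ 2 / (1 - n) ^ 2 ≤ 2 * Real.exp (2 * Bd) := by
          rw [div_le_iff₀ (by positivity)]; linarith
        have m3 : 0 ≤ 8 * X := le_trans (by positivity) m1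
        gcongr
    _ = _ := by ring


/-- Abstract unimodality. -/
structure UM (f : ℝ → ℝ) : Prop where
  pos : ∀ x y, 0 ≤ x → x < y → f x < f y
  neg : ∀ x y, x < y → y ≤ 0 → f y < f x

lemma UM.uIcc {f : ℝ → ℝ} (h : UM f) {a z b : ℝ} (haz : 0 < a * z) (hb : b ∈ Set.uIcc a z) :
    f b ∈ Set.uIcc (f a) (f z) := by
  have hp : StrictMonoOn f (Set.Ici 0) := fun x hx y _ hxy => h.pos x y hx hxy
  have hn : StrictAntiOn f (Set.Iic 0) := fun x _ y hy hxy => h.neg x y hxy hy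
  rcases pos_and_pos_or_neg_and_neg_of_mul_pos haz with ⟨h1, h2⟩ | ⟨h1, h2⟩
  · have hs : Set.uIcc a z ⊆ Set.Ici 0 := by
      intro y hy; exact (le_min h1.le h2.le).trans hy.1
    rcases le_total a z with h3 | h3
    · rw [Set.uIcc_of_le h3] at *
      rw [Set.uIcc_of_le (hp.monotoneOn h1.le h2.le h3)]
      exact ⟨hp.monotoneOn h1.le (hs hb) hb.1, hp.monotoneOn (hs hb) h2.le hb.2⟩
    · rw [Set.uIcc_of_ge h3] at *
      rw [Set.uIcc_of_ge (hp.monotoneOn h2.le h1.le h3)]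
      exact ⟨hp.monotoneOn h2.le (hs hb) hb.1, hp.monotoneOn (hs hb) h1.le hb.2⟩
  · have hs : Set.uIcc a z ⊆ Set.Iic 0 := by
      intro y hy; exact hy.2.trans (max_le h1.le h2.le)
    rcases le_total a z with h3 | h3
    · rw [Set.uIcc_of_le h3] at *
      rw [Set.uIcc_of_ge (hn.antitoneOn h1.le h2.le h3)]
      exact ⟨hn.antitoneOn (hs hb) h2.le hb.2, hn.antitoneOn h1.le (hs hb) hb.1⟩
    · rw [Set.uIcc_of_ge h3] at *
      rw [Set.uIcc_of_le (hn.antitoneOn h2.le h1.le h3)]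
      exact ⟨hn.antitoneOn (hs hb) h1.le hb.2, hn.antitoneOn h2.le (hs hb) hb.1⟩

lemma uIcc_pos {x y b : ℝ} (hx : 0 < x) (hy : 0 < y) (hb : b ∈ Set.uIcc x y) : 0 < b :=
  (lt_min hx hy).trans_le hb.1

lemma uIcc_neg {x y b : ℝ} (hx : x < 0) (hy : y < 0) (hb : b ∈ Set.uIcc x y) : b < 0 :=
  hb.2.trans_lt (max_lt hx hy)

/-- Crossing traces. -/
inductive Tr (f : ℝ → ℝ) : ℕ → ℕ → ℕ → ℝ → ℝ → Prop
  | cross (a z : ℝ) : 0 < a * z → a ≠ z → f a * f z ≤ 0 → Tr f 1 0 0 a z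
  | pos (A N t : ℕ) (a z : ℝ) : 0 < a * z → 0 < f a → 0 < f z → Tr f A N t (f a) (f z) →
      Tr f (A + 1) N (t + 1) a z
  | neg (A N t : ℕ) (a z : ℝ) : 0 < a * z → f a < 0 → f z < 0 → Tr f A N t (f a) (f z) →
      Tr f (A + 1) (N + 1) 0 a z

lemma Tr.mul_pos {f : ℝ → ℝ} {A N t : ℕ} {a z : ℝ} (h : Tr f A N t a z) : 0 < a * z := by
  cases h <;> assumption

lemma Tr.symm {f : ℝ → ℝ} {A N t : ℕ} {a z : ℝ} (h : Tr f A N t a z) : Tr f A N t z a := by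
  induction h with
  | cross a z h1 h2 h3 => exact .cross _ _ (by rwa [mul_comm]) h2.symm (by rwa [mul_comm])
  | pos A N t a z h1 h2 h3 _ ih => exact .pos _ _ _ _ _ (by rwa [mul_comm]) h3 h2 ih
  | neg A N t a z h1 h2 h3 _ ih => exact .neg _ _ _ _ _ (by rwa [mul_comm]) h3 h2 ih

lemma Tr.t_lt {f : ℝ → ℝ} {A N t : ℕ} {a z : ℝ} (h : Tr f A N t a z) : t + 1 ≤ A := by
  induction h <;> omega

lemma Tr.iter_pos {f : ℝ → ℝ} (hf : UM f) {A N t : ℕ} {a z : ℝ} (h : Tr f A N t a z) :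
    ∀ b ∈ Set.uIcc a z, ∀ s, 1 ≤ s → s ≤ t → 0 < f^[s] b := by
  induction h with
  | cross a z h1 h2 h3 => intro b _ s h4 h5; omega
  | neg A N t a z h1 h2 h3 _ ih => intro b _ s h4 h5; omega
  | pos A N t a z h1 h2 h3 _ ih =>
    intro b hb s h4 h5
    have hb' := hf.uIcc h1 hb
    obtain ⟨s, rfl⟩ : ∃ k, s = k + 1 := ⟨s - 1, by omega⟩
    rw [Function.iterate_succ_apply]
    rcases Nat.eq_zero_or_pos s with rfl | hs
    · exact uIcc_pos h2 h3 hb'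
    · exact ih _ hb' s hs (by omega)

lemma Tr.comb {f : ℝ → ℝ} (hf : UM f) {A N t : ℕ} {a z : ℝ} (h : Tr f A N t a z) :
    ∀ u, 0 < u * z → a ∈ Set.uIcc u z → ∃ A' N' t', A' ≤ A ∧ N' ≤ N ∧ Tr f A' N' t' u z := by
  induction h with
  | cross a z h1 h2 h3 =>
    intro u hu ha
    have hb' := hf.uIcc hu ha
    refine ⟨1, 0, 0, le_rfl, le_rfl, .cross _ _ hu ?_ ?_⟩
    · rintro rfl; simp at ha; exact h2 ha
    · by_contra! h4
      rcases pos_and_pos_or_neg_and_neg_of_mul_pos h4 with ⟨h5, h6⟩ | ⟨h5, h6⟩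
      · have := uIcc_pos h5 h6 hb'; nlinarith
      · have := uIcc_neg h5 h6 hb'; nlinarith
  | pos A N t a z h1 h2 h3 _ ih =>
    intro u hu ha
    have hb' := hf.uIcc hu ha
    by_cases h4 : 0 < f u
    · obtain ⟨A', N', t', hA, hN, h⟩ := ih (f u) (by positivity) hb'
      exact ⟨A' + 1, N', t' + 1, by omega, hN, .pos _ _ _ _ _ hu h4 h3 h⟩
    · refine ⟨1, 0, 0, by omega, by omega, .cross _ _ hu ?_ ?_⟩
      · rintro rfl; exact h4 h3
      · nlinarith
  | neg A N t a z h1 h2 h3 _ ih =>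
    intro u hu ha
    have hb' := hf.uIcc hu ha
    by_cases h4 : f u < 0
    · obtain ⟨A', N', t', hA, hN, h⟩ := ih (f u) (by nlinarith) hb'
      exact ⟨A' + 1, N' + 1, 0, by omega, by omega, .neg _ _ _ _ _ hu h4 h3 h⟩
    · refine ⟨1, 0, 0, by omega, by omega, .cross _ _ hu ?_ ?_⟩
      · rintro rfl; exact h4 h3
      · nlinarith

lemma Tr.exist {f : ℝ → ℝ} {q : ℕ} (hq : f^[q] 0 = 0)
    (hne : ∀ j, 1 ≤ j → j < q → f^[j] 0 ≠ 0) :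
    ∀ m i j : ℕ, 1 ≤ i → i < j → j + m + 1 = q → 0 < f^[i] 0 * f^[j] 0 →
    ∃ A N t, A ≤ m + 1 ∧ N ≤ ((Finset.Ioo i q).filter (fun k => f^[k] 0 < 0)).card ∧
      Tr f A N t (f^[i] 0) (f^[j] 0) := by
  intro m
  induction m with
  | zero =>
    intro i j hi hij hj hp
    have e1 : f (f^[j] 0) = 0 := by
      rw [← Function.iterate_succ_apply' f, show j.succ = q by omega, hq]
    have e2 : f (f^[i] 0) ≠ 0 := by
      rw [← Function.iterate_succ_apply' f]; exact hne _ (by omega) (by omega)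
    refine ⟨1, 0, 0, le_rfl, Nat.zero_le _, .cross _ _ hp ?_ (by rw [e1]; simp)⟩
    intro h; rw [h] at e2; exact e2 e1
  | succ m ih =>
    intro i j hi hij hj hp
    have e1 : f (f^[j] 0) ≠ 0 := by
      rw [← Function.iterate_succ_apply' f]; exact hne _ (by omega) (by omega)
    have e2 : f (f^[i] 0) ≠ 0 := by
      rw [← Function.iterate_succ_apply' f]; exact hne _ (by omega) (by omega)
    by_cases h : f (f^[i] 0) * f (f^[j] 0) ≤ 0
    · refine ⟨1, 0, 0, by omega, Nat.zero_le _, .cross _ _ hp ?_ h⟩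
      intro h'; rw [h'] at h
      have := mul_self_pos.2 e1; linarith
    · push Not at h
      have h' := h
      rw [← Function.iterate_succ_apply' f, ← Function.iterate_succ_apply' f] at h'
      obtain ⟨A, N, t, hA, hN, hT⟩ := ih (i + 1) (j + 1) (by omega) (by omega) (by omega) h'
      rw [Function.iterate_succ_apply', Function.iterate_succ_apply'] at hT
      have hsub : (Finset.Ioo (i + 1) q).filter (fun k => f^[k] 0 < 0) ⊆
          (Finset.Ioo i q).filter (fun k => f^[k] 0 < 0) := by
        apply Finset.filter_subset_filter
        intro k hk; rw [Finset.mem_Ioo] at *; omega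
      rcases pos_and_pos_or_neg_and_neg_of_mul_pos h with ⟨h5, h6⟩ | ⟨h5, h6⟩
      · exact ⟨A + 1, N, t + 1, by omega, hN.trans (Finset.card_le_card hsub),
          .pos _ _ _ _ _ hp h5 h6 hT⟩
      · refine ⟨A + 1, N + 1, 0, by omega, ?_, .neg _ _ _ _ _ hp h5 h6 hT⟩
        have : ((Finset.Ioo (i + 1) q).filter (fun k => f^[k] 0 < 0)).card <
          ((Finset.Ioo i q).filter (fun k => f^[k] 0 < 0)).card := by
          apply Finset.card_lt_card
          refine ⟨hsub, fun hs => ?_⟩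
          have : i + 1 ∈ (Finset.Ioo i q).filter (fun k => f^[k] 0 < 0) := by
            rw [Finset.mem_filter, Finset.mem_Ioo]
            refine ⟨by omega, ?_⟩
            rw [Function.iterate_succ_apply']; exact h5
          have := hs this
          simp at this
        omega


/-- Logarithmic increment at `y`. -/
noncomputable def mu (f : ℝ → ℝ) (ξ : ℕ → ℝ → ℂ) (n : ℕ) (y : ℝ) : ℂ :=
  if 0 < y then Complex.log (1 + Complex.exp (ξ n y - ξ n (f 0)))
  else if y < 0 then Complex.log (1 - Complex.exp (ξ n y - ξ n (f 0))) else 0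

structure Sys (f : ℝ → ℝ) (P : Set ℝ) (q : ℕ) (ell th : ℝ) (w : ℝ → ℝ) (ξ : ℕ → ℝ → ℂ) :
    Prop where
  um : UM f
  inv : ∀ y ∈ P, f y ∈ P
  c0 : f 0 ∈ P
  c0neg : f 0 < 0
  lo : ∀ y ∈ P, f 0 ≤ y
  hi : ∀ y ∈ P, y ≤ f (f 0)
  th0 : 0 < th
  th1 : th ≤ 1 / 100
  ell1 : 100 ≤ ell
  w_ge : ∀ a, ell ≤ w a
  w_eq : ∀ a z, 0 < a * z → w a = w z
  r1 : ∀ n < q, ∀ a ∈ P, a ≠ 0 → |(ξ n a).im| ≤ 4 * th / ell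
  r2 : ∀ n < q, ∀ a ∈ P, ∀ b ∈ P, 0 < a * b → |b| < |a| → (ξ n b).re < (ξ n a).re ∧
    |(ξ n a).im - (ξ n b).im| ≤ 2 * th * (1 - Real.exp (-((ξ n a).re - (ξ n b).re)))
  lift : ∀ n < q, ∀ a ∈ P, a ≠ 0 → (f a = 0 → 1 ≤ n) →
    (w a : ℂ) * ξ (n + 1) a = ξ n (f 0) + mu f ξ n (f a)

section
variable {f : ℝ → ℝ} {P : Set ℝ} {q : ℕ} {ell th : ℝ} {w : ℝ → ℝ} {ξ : ℕ → ℝ → ℂ}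

noncomputable def RR (f : ℝ → ℝ) (ξ : ℕ → ℝ → ℂ) (n : ℕ) (y : ℝ) : ℝ :=
  Real.exp ((ξ n y).re - (ξ n (f 0)).re)
noncomputable def dd (f : ℝ → ℝ) (ξ : ℕ → ℝ → ℂ) (n : ℕ) (y : ℝ) : ℝ :=
  (ξ n y).im - (ξ n (f 0)).im

lemma RR_pos (n : ℕ) (y : ℝ) : 0 < RR f ξ n y := Real.exp_pos _

lemma mu_pos {n : ℕ} {y : ℝ} (hy : 0 < y) :
    mu f ξ n y = Complex.log (pY (RR f ξ n y) (dd f ξ n y)) := by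
  rw [mu, if_pos hy, pY_eq]; rfl

lemma mu_neg {n : ℕ} {y : ℝ} (hy : y < 0) :
    mu f ξ n y = Complex.log (nY (RR f ξ n y) (dd f ξ n y)) := by
  rw [mu, if_neg (by linarith), if_pos hy, nY_eq]; rfl

lemma mu_zero {n : ℕ} : mu f ξ n 0 = 0 := by simp [mu]

namespace Sys

lemma dd_le (S : Sys f P q ell th w ξ) {n : ℕ} (hn : n < q) {y : ℝ} (hy : y ∈ P) (hy0 : y ≠ 0) :
    |dd f ξ n y| ≤ 8 * th / ell := by
  have h1 := S.r1 n hn y hy hy0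
  have h2 := S.r1 n hn _ S.c0 S.c0neg.ne
  refine (abs_sub _ _).trans ?_
  have : 8 * th / ell = 4 * th / ell + 4 * th / ell := by ring
  linarith

lemma eps_le (S : Sys f P q ell th w ξ) : 8 * th / ell ≤ 1 / 1000 := by
  have := S.ell1; have := S.th1; have := S.th0
  rw [div_le_iff₀ (by linarith)]; linarith

lemma dd_le' (S : Sys f P q ell th w ξ) {n : ℕ} (hn : n < q) {y : ℝ} (hy : y ∈ P) (hy0 : y ≠ 0) :
    |dd f ξ n y| ≤ 1 / 1000 := (S.dd_le hn hy hy0).trans S.eps_le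

lemma RR_lt (S : Sys f P q ell th w ξ) {n : ℕ} (hn : n < q) {y y' : ℝ} (hy : y ∈ P) (hy' : y' ∈ P) (h : 0 < y' * y)
    (hlt : |y| < |y'|) :
    RR f ξ n y < RR f ξ n y' ∧
    RR f ξ n y' * |dd f ξ n y' - dd f ξ n y| ≤ 2 * th * (RR f ξ n y' - RR f ξ n y) := by
  obtain ⟨h1, h2⟩ := S.r2 n hn y' hy' y hy h hlt
  refine ⟨Real.exp_lt_exp.2 (by linarith), ?_⟩
  have e1 : dd f ξ n y' - dd f ξ n y = (ξ n y').im - (ξ n y).im := by simp only [dd]; ring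
  have e2 : RR f ξ n y' * Real.exp (-((ξ n y').re - (ξ n y).re)) = RR f ξ n y := by
    simp only [RR]; rw [← Real.exp_add]; congr 1; ring
  rw [e1]
  calc _ ≤ RR f ξ n y' * (2 * th * (1 - Real.exp (-((ξ n y').re - (ξ n y).re)))) := by
        have := RR_pos (f := f) (ξ := ξ) n y'
        gcongr
    _ = 2 * th * (RR f ξ n y' - RR f ξ n y' * Real.exp (-((ξ n y').re - (ξ n y).re))) := by ring
    _ = _ := by rw [e2]

lemma RR_le (S : Sys f P q ell th w ξ) {n : ℕ} (hn : n < q) {y y' : ℝ} (hy : y ∈ P) (hy' : y' ∈ P) (h : 0 < y' * y)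
    (hlt : |y| ≤ |y'|) :
    RR f ξ n y ≤ RR f ξ n y' ∧
    RR f ξ n y' * |dd f ξ n y' - dd f ξ n y| ≤ 2 * th * (RR f ξ n y' - RR f ξ n y) := by
  rcases hlt.lt_or_eq with h1 | h1
  · have := S.RR_lt hn hy hy' h h1; exact ⟨this.1.le, this.2⟩
  · have : y = y' := by
      rcases pos_and_pos_or_neg_and_neg_of_mul_pos h with ⟨h2, h3⟩ | ⟨h2, h3⟩
      · rwa [abs_of_pos h2, abs_of_pos h3] at h1
      · rw [abs_of_neg h2, abs_of_neg h3] at h1; linarith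
    subst this; simp

lemma neg_small (S : Sys f P q ell th w ξ) {n : ℕ} (hn : n < q) {y : ℝ} (hy : y ∈ P) (hy0 : y < 0) (hyc : f 0 < y) :
    RR f ξ n y < 1 ∧ |dd f ξ n y| ≤ 2 * th * (1 - RR f ξ n y) := by
  have h := S.RR_lt hn hy S.c0 (mul_pos_of_neg_of_neg S.c0neg hy0)
    (by rw [abs_of_neg hy0, abs_of_neg S.c0neg]; linarith)
  have e1 : RR f ξ n (f 0) = 1 := by simp [RR]
  have e2 : dd f ξ n (f 0) = 0 := by simp [dd]
  rw [e1, e2, zero_sub, abs_neg, one_mul] at h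
  exact h

lemma mu_re_pos (S : Sys f P q ell th w ξ) {n : ℕ} (hn : n < q) {y : ℝ} (hy : y ∈ P) (hy0 : 0 < y) :
    0 ≤ (mu f ξ n y).re := by
  rw [mu_pos hy0, Complex.log_re]
  apply Real.log_nonneg
  have h1 := pY_re (RR_pos (f := f) (ξ := ξ) n y) ((S.dd_le' hn hy hy0.ne').trans (by norm_num))
  have h2 := Complex.abs_re_le_norm (pY (RR f ξ n y) (dd f ξ n y))
  have h3 := le_abs_self (pY (RR f ξ n y) (dd f ξ n y)).re
  linarith

lemma mu_re_neg (S : Sys f P q ell th w ξ) {n : ℕ} (hn : n < q) {y : ℝ} (hy : y ∈ P) (hy0 : y < 0) (hyc : f 0 < y) :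
    (mu f ξ n y).re ≤ 0 := by
  obtain ⟨h1, h2⟩ := S.neg_small hn hy hy0 hyc
  have hr := RR_pos (f := f) (ξ := ξ) n y
  rw [mu_neg hy0]
  have := nY_logre hr h1 S.th0.le S.th1 h2
  have := Real.log_nonpos (show 0 ≤ 1 - RR f ξ n y by linarith) (by linarith)
  linarith

lemma mu_mono (S : Sys f P q ell th w ξ) {n : ℕ} (hn : n < q) {y y' : ℝ} (hy : y ∈ P) (hy' : y' ∈ P) (hyc : f 0 < y)
    (hyy : y ≤ y') : (mu f ξ n y).re ≤ (mu f ξ n y').re := by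
  rcases lt_trichotomy y 0 with h | h | h
  · have k1 := S.mu_re_neg hn hy h hyc
    rcases lt_trichotomy y' 0 with h' | h' | h'
    · obtain ⟨a1, a2⟩ := S.neg_small hn hy h hyc
      obtain ⟨b1, b2⟩ := S.neg_small hn hy' h' (by linarith)
      obtain ⟨c1, c2⟩ := S.RR_le hn hy' hy (mul_pos_of_neg_of_neg h h')
        (by rw [abs_of_neg h, abs_of_neg h']; linarith)
      have hr := RR_pos (f := f) (ξ := ξ) n y'
      have := nY_mono hr c1 a1 S.th0.le S.th1 a2 b2 c2
      rw [mu_neg h, mu_neg h']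
      have : 0 ≤ (RR f ξ n y - RR f ξ n y') / (1 - RR f ξ n y') / 8 := by
        apply div_nonneg (div_nonneg _ _) <;> linarith
      linarith
    · subst h'; rw [mu_zero]; simpa using k1
    · exact k1.trans (S.mu_re_pos hn hy' h')
  · subst h
    rcases hyy.lt_or_eq with h' | h'
    · rw [mu_zero]; simpa using S.mu_re_pos hn hy' h'
    · rw [← h']
  · have h' : 0 < y' := by linarith
    obtain ⟨c1, c2⟩ := S.RR_le hn hy hy' (mul_pos h' h)
        (by rw [abs_of_pos h, abs_of_pos h']; linarith)
    have hr := RR_pos (f := f) (ξ := ξ) n y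
    have := pY_mono hr c1 (S.dd_le' hn hy' h'.ne') (S.dd_le' hn hy h.ne') (by norm_num) S.th0.le
      S.th1 c2
    rw [mu_pos h, mu_pos h']
    have : 0 ≤ (1 - 1 / 1000) * (RR f ξ n y' - RR f ξ n y) / (1 + RR f ξ n y') := by
      apply div_nonneg (mul_nonneg _ _) <;> linarith
    linarith

lemma mu_cross (S : Sys f P q ell th w ξ) {n : ℕ} (hn : n < q) {y k : ℝ} (hy : y ∈ P) (hyc : f 0 < y) (hk : 0 < k)
    (hk1 : 16 / k ≤ ell) (hk2 : 16 / (k * Real.exp (-(4 / k))) ≤ ell) :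
    |(mu f ξ n y).im| ≤ k * th * |(mu f ξ n y).re| := by
  have hr := RR_pos (f := f) (ξ := ξ) n y
  rcases lt_trichotomy y 0 with h | h | h
  · obtain ⟨a1, a2⟩ := S.neg_small hn hy h hyc
    have := nY_cross hr a1 S.th0.le S.th1 a2 hk hk2 (S.dd_le hn hy h.ne)
    rw [abs_of_nonpos (S.mu_re_neg hn hy h hyc), mu_neg h, Complex.log_im]
    exact this
  · subst h; rw [mu_zero]; simp
  · have k1 := pY_cross hr ((S.dd_le' hn hy h.ne').trans (by norm_num))
    have k2 := S.mu_re_pos hn hy h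
    rw [abs_of_nonneg k2]
    rw [mu_pos h] at *
    rw [Complex.log_im]
    refine k1.trans ?_
    have := S.dd_le hn hy h.ne'
    have he := S.ell1
    have ht := S.th0
    have : 8 * th / ell ≤ k * th / 2 := by
      rw [div_le_iff₀ (by linarith)]
      rw [div_le_iff₀ hk] at hk1
      nlinarith
    apply mul_le_mul_of_nonneg_right _ k2
    linarith

/-- Reduction of the comparison at level `n+1` to the `mu`'s at level `n`. -/
lemma reduce (S : Sys f P q ell th w ξ) {n : ℕ} (hn : n < q) (hn1 : 1 ≤ n) {a b z K : ℝ} (ha : a ∈ P) (hb : b ∈ P)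
    (hz : z ∈ P) (haz : 0 < a * z) (hbz : b ∈ Set.uIcc a z)
    (h : |(mu f ξ n (f a)).im - (mu f ξ n (f b)).im| ≤
      K * |(mu f ξ n (f a)).re - (mu f ξ n (f z)).re|) :
    |(ξ (n + 1) a).im - (ξ (n + 1) b).im| ≤
      K * |(ξ (n + 1) a).re - (ξ (n + 1) z).re| := by
  have hab : 0 < a * b := by
    rcases pos_and_pos_or_neg_and_neg_of_mul_pos haz with ⟨h2, h3⟩ | ⟨h2, h3⟩
    · exact mul_pos h2 (uIcc_pos h2 h3 hbz)
    · exact mul_pos_of_neg_of_neg h2 (uIcc_neg h2 h3 hbz)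
  have l1 := S.lift n hn a ha (by rintro rfl; simp at haz) (fun _ => hn1)
  have l2 := S.lift n hn b hb (by rintro rfl; simp at hab) (fun _ => hn1)
  have l3 := S.lift n hn z hz (by rintro rfl; simp at haz) (fun _ => hn1)
  rw [← S.w_eq a b hab] at l2
  rw [← S.w_eq a z haz] at l3
  have hw : 0 < w a := by have := S.w_ge a; have := S.ell1; linarith
  have i1 := congrArg Complex.im l1
  have i2 := congrArg Complex.im l2
  have i3 := congrArg Complex.re l1
  have i4 := congrArg Complex.re l3
  simp only [Complex.re_ofReal_mul, Complex.im_ofReal_mul, Complex.add_re, Complex.add_im] at i1 i2 i3 i4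
  have e1 : (mu f ξ n (f a)).im - (mu f ξ n (f b)).im =
    w a * ((ξ (n + 1) a).im - (ξ (n + 1) b).im) := by linarith
  have e2 : (mu f ξ n (f a)).re - (mu f ξ n (f z)).re =
    w a * ((ξ (n + 1) a).re - (ξ (n + 1) z).re) := by linarith
  rw [e1, e2, abs_mul, abs_mul, abs_of_pos hw] at h
  have : w a * |(ξ (n + 1) a).im - (ξ (n + 1) b).im| ≤
    w a * (K * |(ξ (n + 1) a).re - (ξ (n + 1) z).re|) := by linarith
  exact le_of_mul_le_mul_left this hw

lemma c_lt (S : Sys f P q ell th w ξ) {a : ℝ} (ha : a ≠ 0) : f 0 < f a := by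
  rcases lt_or_gt_of_ne ha with h | h
  · exact S.um.neg a 0 h le_rfl
  · exact S.um.pos 0 a le_rfl h

/-- Lemma V. -/
lemma decay (S : Sys f P q ell th w ξ) {t : ℕ} : ∀ {n : ℕ}, n < q → t ≤ n → ∀ {y : ℝ}, y ∈ P → y ≠ 0 →
    (∀ s, 1 ≤ s → s ≤ t → 0 < f^[s] y) → |(ξ n y).im| ≤ 4 * th / ell * (1 / 16) ^ t := by
  induction t with
  | zero => intro n hn _ y hy hy0 _; simpa using S.r1 n hn y hy hy0
  | succ t ih =>
    intro n hn htn y hy hy0 hs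
    obtain ⟨n, rfl⟩ : ∃ k, n = k + 1 := ⟨n - 1, by omega⟩
    have hfy : 0 < f y := by simpa using hs 1 le_rfl (by omega)
    have hK : ∀ s, 1 ≤ s → s ≤ t → 0 < f^[s] (f y) := by
      intro s h1 h2
      rw [← Function.iterate_succ_apply]; exact hs _ (by omega) (by omega)
    have hmono : ∀ s, (∀ k, k ≤ s → 0 < f^[k] (f y)) → f^[s] (f y) ≤ f^[s] (f (f 0)) := by
      intro s
      induction s with
      | zero => intro _; simpa using S.hi _ (S.inv _ hy)
      | succ s ihs =>
        intro hk
        have h1 := ihs (fun k hks => hk k (by omega))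
        have h2 := hk s (by omega)
        rw [Function.iterate_succ_apply', Function.iterate_succ_apply']
        rcases h1.lt_or_eq with h | h
        · exact (S.um.pos _ _ h2.le h).le
        · rw [h]
    have hC : ∀ s, 1 ≤ s → s ≤ t → 0 < f^[s] (f 0) := by
      intro s h1 h2
      obtain ⟨s, rfl⟩ : ∃ k, s = k + 1 := ⟨s - 1, by omega⟩
      rw [Function.iterate_succ_apply]
      refine lt_of_lt_of_le ?_ (hmono s ?_)
      · rw [← Function.iterate_succ_apply]; exact hs _ (by omega) (by omega)
      · intro k hk
        rw [← Function.iterate_succ_apply]; exact hs _ (by omega) (by omega)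
    have v1 := ih (n := n) (by omega) (by omega) (S.inv _ hy) hfy.ne' hK
    have v2 := ih (n := n) (by omega) (by omega) S.c0 S.c0neg.ne hC
    have hl := S.lift n (by omega) y hy hy0 (fun h => by rw [h] at hfy; simp at hfy)
    have hi := congrArg Complex.im hl
    simp only [Complex.im_ofReal_mul, Complex.add_im] at hi
    rw [mu_pos hfy, Complex.log_im] at hi
    have harg := pY_arg (RR_pos (f := f) (ξ := ξ) n (f y))
      ((S.dd_le' (n := n) (by omega) (S.inv _ hy) hfy.ne').trans (by norm_num))
    set V := 4 * th / ell * (1 / 16) ^ t with hV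
    have hdd : |dd f ξ n (f y)| ≤ 2 * V := by
      refine (abs_sub _ _).trans ?_; linarith
    have hw := S.w_ge y
    have he := S.ell1
    have h5 : w y * |(ξ (n + 1) y).im| ≤ 5 * V := by
      rw [← abs_of_pos (show 0 < w y by linarith), ← abs_mul, hi]
      refine (abs_add_le _ _).trans ?_
      linarith
    have h6 : 100 * |(ξ (n + 1) y).im| ≤ w y * |(ξ (n + 1) y).im| := by gcongr; linarith
    have hV0 : 0 ≤ V := (abs_nonneg _).trans v1
    rw [pow_succ]
    linarith

end Sys
end


lemma aux_min1 {x e u : ℝ} (he : 0 ≤ e) (hu : 0 ≤ u) (h1 : x ≤ e * u) (h2 : x ≤ e) :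
    x ≤ 2 * e * (1 - Real.exp (-u)) := by
  have h := @aux_E_le u
  have hE : 0 ≤ 1 - Real.exp (-u) := by
    have := Real.exp_le_one_iff.2 (show -u ≤ 0 by linarith); linarith
  rcases le_total u 1 with h3 | h3
  · have : u ≤ 2 * (1 - Real.exp (-u)) := by nlinarith
    nlinarith
  · have : 1 ≤ 2 * (1 - Real.exp (-u)) := by
      have h4 : Real.exp (-u) ≤ Real.exp (-1) := Real.exp_le_exp.2 (by linarith)
      have h5 := @aux_E_le 1
      linarith
    nlinarith

section
variable {f : ℝ → ℝ} {P : Set ℝ} {q : ℕ} {ell th : ℝ} {w : ℝ → ℝ} {ξ : ℕ → ℝ → ℂ}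

namespace Sys

lemma cross_step (S : Sys f P q ell th w ξ) {n : ℕ} (hn : n < q) {α β γ k : ℝ} (hα : α ∈ P) (hβ : β ∈ P) (hγ : γ ∈ P)
    (cα : f 0 < α) (cβ : f 0 < β) (cγ : f 0 < γ)
    (hb : β ∈ Set.uIcc α γ) (h : α * γ ≤ 0) (hk : 0 < k)
    (hk1 : 16 / k ≤ ell) (hk2 : 16 / (k * Real.exp (-(4 / k))) ≤ ell) :
    |(mu f ξ n α).im - (mu f ξ n β).im| ≤
      2 * k * th * |(mu f ξ n α).re - (mu f ξ n γ).re| := by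
  have i1 := S.mu_cross hn hα cα hk hk1 hk2
  have i2 := S.mu_cross hn hβ cβ hk hk1 hk2
  have hkt : 0 < k * th := mul_pos hk S.th0
  have hre0 : ∀ y ∈ P, f 0 < y → (0 ≤ y → 0 ≤ (mu f ξ n y).re) ∧ (y ≤ 0 → (mu f ξ n y).re ≤ 0) := by
    intro y hy hc
    constructor
    · intro h
      rcases h.lt_or_eq with h | h
      · exact S.mu_re_pos hn hy h
      · rw [← h, mu_zero]; simp
    · intro h
      rcases h.lt_or_eq with h | h
      · exact S.mu_re_neg hn hy h hc
      · rw [h, mu_zero]; simp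
  suffices hs : |(mu f ξ n α).re| + |(mu f ξ n β).re| ≤
      2 * |(mu f ξ n α).re - (mu f ξ n γ).re| by
    refine (abs_sub _ _).trans ?_
    calc _ ≤ k * th * (|(mu f ξ n α).re| + |(mu f ξ n β).re|) := by linarith
      _ ≤ k * th * (2 * |(mu f ξ n α).re - (mu f ξ n γ).re|) := by gcongr
      _ = _ := by ring
  have hc : (α ≤ 0 ∧ 0 ≤ γ) ∨ (γ ≤ 0 ∧ 0 ≤ α) := by
    rcases le_total α 0 with h1 | h1 <;> rcases le_total γ 0 with h2 | h2
    · rcases h1.lt_or_eq with h3 | h3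
      · rcases h2.lt_or_eq with h4 | h4
        · nlinarith
        · exact .inl ⟨h1, h4.ge⟩
      · exact .inr ⟨h2, h3.ge⟩
    · exact .inl ⟨h1, h2⟩
    · exact .inr ⟨h2, h1⟩
    · rcases h1.lt_or_eq with h3 | h3
      · rcases h2.lt_or_eq with h4 | h4
        · nlinarith
        · exact .inr ⟨h4.ge, h1⟩
      · exact .inl ⟨h3.ge, h2⟩
  rcases hc with ⟨h1, h2⟩ | ⟨h1, h2⟩
  · rw [Set.uIcc_of_le (by linarith)] at hb
    have a1 := S.mu_mono hn hα hβ cα hb.1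
    have a2 := S.mu_mono hn hβ hγ cβ hb.2
    have a3 := (hre0 _ hα cα).2 h1
    have a4 := (hre0 _ hγ cγ).1 h2
    rw [abs_of_nonpos a3, abs_of_nonpos (show (mu f ξ n α).re - (mu f ξ n γ).re ≤ 0 by linarith)]
    rcases abs_cases (mu f ξ n β).re with ⟨h, _⟩ | ⟨h, _⟩ <;> linarith
  · rw [Set.uIcc_of_ge (by linarith)] at hb
    have a1 := S.mu_mono hn hγ hβ cγ hb.1
    have a2 := S.mu_mono hn hβ hα cβ hb.2
    have a3 := (hre0 _ hα cα).1 h2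
    have a4 := (hre0 _ hγ cγ).2 h1
    rw [abs_of_nonneg a3, abs_of_nonneg (show 0 ≤ (mu f ξ n α).re - (mu f ξ n γ).re by linarith)]
    rcases abs_cases (mu f ξ n β).re with ⟨h, _⟩ | ⟨h, _⟩ <;> linarith

lemma pos_step (S : Sys f P q ell th w ξ) {n : ℕ} (hn : n < q) {α β γ e : ℝ} (hα : α ∈ P) (hβ : β ∈ P) (hγ : γ ∈ P)
    (cα : 0 < α) (cγ : 0 < γ) (hb : β ∈ Set.uIcc α γ)
    (dα : |dd f ξ n α| ≤ e) (dβ : |dd f ξ n β| ≤ e) (dγ : |dd f ξ n γ| ≤ e) (he : e ≤ 1 / 10) :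
    |(mu f ξ n α).im - (mu f ξ n β).im| *
        (1 - Real.exp (-|(ξ n α).re - (ξ n γ).re|)) ≤
      (1 + 3 * e) * (|(ξ n α).im - (ξ n β).im| +
        e * (1 - Real.exp (-|(ξ n α).re - (ξ n γ).re|))) *
      |(mu f ξ n α).re - (mu f ξ n γ).re| := by
  have cβ := uIcc_pos cα cγ hb
  have key : ∀ σ τ : ℝ, σ ∈ P → τ ∈ P → 0 < σ → 0 < τ → σ ≤ τ → |dd f ξ n σ| ≤ e →
      |dd f ξ n τ| ≤ e → α ∈ Set.Icc σ τ → β ∈ Set.Icc σ τ →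
      |(mu f ξ n α).im - (mu f ξ n β).im| * (1 - RR f ξ n σ / RR f ξ n τ) ≤
      (1 + 3 * e) * (|dd f ξ n α - dd f ξ n β| + e * (1 - RR f ξ n σ / RR f ξ n τ)) *
      ((mu f ξ n τ).re - (mu f ξ n σ).re) := by
    intro σ τ hσ hτ pσ pτ hle dσ dτ ha hb
    have m : ∀ x ∈ P, ∀ y ∈ P, 0 < x → x ≤ y → RR f ξ n x ≤ RR f ξ n y := by
      intro x hx y hy h0 hxy
      have h1 : 0 < y := by linarith
      exact (S.RR_le hn hx hy (mul_pos h1 h0) (by rwa [abs_of_pos h0, abs_of_pos h1])).1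
    have hh := (S.RR_le hn hσ hτ (mul_pos pτ pσ) (by rwa [abs_of_pos pσ, abs_of_pos pτ])).2
    have := pY_step (RR_pos n σ) (m _ hσ _ hα pσ ha.1) (m _ hα _ hτ cα ha.2)
      (m _ hσ _ hβ pσ hb.1) (m _ hβ _ hτ cβ hb.2) dα dβ dτ dσ he S.th0.le S.th1 hh
    rw [mu_pos cα, mu_pos cβ, mu_pos pσ, mu_pos pτ, Complex.log_im, Complex.log_im]
    exact this
  have e1 : dd f ξ n α - dd f ξ n β = (ξ n α).im - (ξ n β).im := by simp only [dd]; ring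
  have e2 : ∀ x y, RR f ξ n x / RR f ξ n y = Real.exp (-((ξ n y).re - (ξ n x).re)) := by
    intro x y; simp only [RR]; rw [← Real.exp_sub]; congr 1; ring
  have hx : ∀ x ∈ P, ∀ y ∈ P, 0 < x → x ≤ y → (ξ n x).re ≤ (ξ n y).re := by
    intro x hx y hy h0 hxy
    rcases hxy.lt_or_eq with h | h
    · exact (S.r2 n hn y hy x hx (by nlinarith) (by rw [abs_of_pos h0, abs_of_pos (by linarith)]; exact h)).1.le
    · rw [h]
  rcases le_total α γ with h | h
  · rw [Set.uIcc_of_le h] at hb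
    have k := key α γ hα hγ cα cγ h dα dγ ⟨le_rfl, h⟩ hb
    rw [e1, e2] at k
    have h1 := S.mu_mono hn hα hγ (by linarith [S.c0neg]) h
    have h2 := hx α hα γ hγ cα h
    rw [abs_sub_comm (ξ n α).re, abs_sub_comm (mu f ξ n α).re,
      abs_of_nonneg (show 0 ≤ (ξ n γ).re - (ξ n α).re by linarith),
      abs_of_nonneg (show 0 ≤ (mu f ξ n γ).re - (mu f ξ n α).re by linarith)]
    exact k
  · rw [Set.uIcc_of_ge h] at hb
    have k := key γ α hγ hα cγ cα h dγ dα ⟨h, le_rfl⟩ hb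
    rw [e1, e2] at k
    have h1 := S.mu_mono hn hγ hα (by linarith [S.c0neg]) h
    have h2 := hx γ hγ α hα cγ h
    rw [abs_of_nonneg (show 0 ≤ (ξ n α).re - (ξ n γ).re by linarith),
      abs_of_nonneg (show 0 ≤ (mu f ξ n α).re - (mu f ξ n γ).re by linarith)]
    exact k

lemma neg_step (S : Sys f P q ell th w ξ) {n : ℕ} (hn : n < q) {α β γ e Bd : ℝ} (hα : α ∈ P) (hβ : β ∈ P) (hγ : γ ∈ P)
    (nα : α < 0) (nγ : γ < 0) (cα : f 0 < α) (cβ : f 0 < β) (cγ : f 0 < γ)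
    (hb : β ∈ Set.uIcc α γ) (he : 0 ≤ e) (hell : 8 / ell ≤ e) (hBd : 0 < Bd)
    (E1 : |(ξ n (f 0)).im - (ξ n β).im| ≤ e * th * |(ξ n (f 0)).re - (ξ n (max α γ)).re|)
    (E2 : |(ξ n α).im - (ξ n β).im| ≤ e * th * |(ξ n α).re - (ξ n γ).re|) :
    |(mu f ξ n α).im - (mu f ξ n β).im| ≤
      max (4 / Bd) (192 * e * Real.exp (2 * Bd)) * th * |(mu f ξ n α).re - (mu f ξ n γ).re| := by
  have nβ := uIcc_neg nα nγ hb
  have ht := S.th0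
  have hl := S.ell1
  have h8 : 8 * th / ell ≤ e * th := by
    calc 8 * th / ell = 8 / ell * th := by ring
      _ ≤ _ := by gcongr
  have hx : ∀ x ∈ P, ∀ y ∈ P, y < 0 → x ≤ y → (ξ n y).re ≤ (ξ n x).re := by
    intro x hx y hy h0 hxy
    rcases hxy.lt_or_eq with h | h
    · exact (S.r2 n hn x hx y hy (by nlinarith) (by rw [abs_of_neg h0, abs_of_neg (by linarith)]; linarith)).1.le
    · rw [h]
  have d1 : |(ξ n α).im - (ξ n β).im| ≤ 8 * th / ell := by
    have h1 := S.r1 n hn α hα nα.ne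
    have h2 := S.r1 n hn β hβ nβ.ne
    refine (abs_sub _ _).trans ?_
    have : 8 * th / ell = 4 * th / ell + 4 * th / ell := by ring
    linarith
  have key : ∀ ν φ : ℝ, ν ∈ P → φ ∈ P → ν < 0 → φ < 0 → f 0 < ν → f 0 < φ → ν ≤ φ →
      α ∈ Set.Icc ν φ → β ∈ Set.Icc ν φ →
      |(ξ n (f 0)).im - (ξ n β).im| ≤ e * th * |(ξ n (f 0)).re - (ξ n φ).re| →
      |(ξ n α).im - (ξ n β).im| ≤ e * th * |(ξ n ν).re - (ξ n φ).re| →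
      |(mu f ξ n α).im - (mu f ξ n β).im| ≤
      max (4 / Bd) (192 * e * Real.exp (2 * Bd)) * th * ((mu f ξ n φ).re - (mu f ξ n ν).re) := by
    intro ν φ hν hφ nν nφ cν cφ hle ha hb E1 E2
    have hre := S.mu_mono hn hν hφ cν hle
    obtain ⟨a1, a2⟩ := S.neg_small hn hα nα cα
    obtain ⟨b1, b2⟩ := S.neg_small hn hβ nβ cβ
    obtain ⟨n1, n2⟩ := S.neg_small hn hν nν cν
    obtain ⟨f1, f2⟩ := S.neg_small hn hφ nφ cφ
    have m : ∀ x ∈ P, ∀ y ∈ P, y < 0 → x ≤ y → RR f ξ n y ≤ RR f ξ n x := by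
      intro x hx y hy h0 hxy
      have h1 : x < 0 := by linarith
      exact (S.RR_le hn hy hx (mul_pos_of_neg_of_neg h1 h0)
        (by rw [abs_of_neg h0, abs_of_neg h1]; linarith)).1
    have hh := (S.RR_le hn hφ hν (mul_pos_of_neg_of_neg nν nφ)
        (by rw [abs_of_neg nν, abs_of_neg nφ]; linarith)).2
    by_cases hc : (mu f ξ n φ).re - (mu f ξ n ν).re ≤ Bd
    · have xc := hx _ S.c0 _ hφ nφ cφ.le
      have xn := hx _ hν _ hφ nφ hle
      rw [abs_of_nonneg (show 0 ≤ (ξ n (f 0)).re - (ξ n φ).re by linarith)] at E1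
      rw [abs_of_nonneg (show 0 ≤ (ξ n ν).re - (ξ n φ).re by linarith)] at E2
      have g1 : |dd f ξ n β| ≤ 2 * (e * th) * (1 - RR f ξ n φ) := by
        have e3 : RR f ξ n φ = Real.exp (-((ξ n (f 0)).re - (ξ n φ).re)) := by
          simp only [RR]; congr 1; ring
        rw [e3]
        apply aux_min1 (by positivity) (by linarith)
        · rw [dd, abs_sub_comm]; exact E1
        · exact (S.dd_le hn hβ nβ.ne).trans h8
      have g2 : RR f ξ n ν * |dd f ξ n α - dd f ξ n β| ≤
          2 * (e * th) * (RR f ξ n ν - RR f ξ n φ) := by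
        have e1 : dd f ξ n α - dd f ξ n β = (ξ n α).im - (ξ n β).im := by simp only [dd]; ring
        have e2 : RR f ξ n ν * Real.exp (-((ξ n ν).re - (ξ n φ).re)) = RR f ξ n φ := by
          simp only [RR]; rw [← Real.exp_add]; congr 1; ring
        have g3 := aux_min1 (by positivity) (by linarith) E2 (d1.trans h8)
        rw [e1]
        have hp := RR_pos (f := f) (ξ := ξ) n ν
        calc _ ≤ RR f ξ n ν * (2 * (e * th) * (1 - Real.exp (-((ξ n ν).re - (ξ n φ).re)))) := by
              gcongr
          _ = 2 * (e * th) * (RR f ξ n ν -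
            RR f ξ n ν * Real.exp (-((ξ n ν).re - (ξ n φ).re))) := by ring
          _ = _ := by rw [e2]
      have hre' := hre
      rw [mu_neg nν, mu_neg nφ] at hc hre' ⊢
      rw [mu_neg nα, mu_neg nβ, Complex.log_im, Complex.log_im]
      have st := nY_step (RR_pos n φ) (m _ hα _ hφ nφ ha.2) (m _ hν _ hα nα ha.1)
        (m _ hβ _ hφ nφ hb.2) (m _ hν _ hβ nβ hb.1) n1 S.th0.le S.th1 a2 b2 (by positivity)
        g1 g2 n2 f2 hh hc
      refine st.trans ?_
      apply mul_le_mul_of_nonneg_right _ (by linarith)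
      calc 96 * (2 * (e * th)) * Real.exp (2 * Bd) = (192 * e * Real.exp (2 * Bd)) * th := by ring
        _ ≤ _ := by gcongr; exact le_max_right _ _
    · push Not at hc
      have q1 := nY_arg' (RR_pos n α) a1 a2
      have q2 := nY_arg' (RR_pos n β) b1 b2
      rw [mu_neg nα, mu_neg nβ, Complex.log_im, Complex.log_im]
      calc _ ≤ 4 * th := (abs_sub _ _).trans (by linarith)
        _ = 4 / Bd * th * Bd := by field_simp
        _ ≤ _ := by gcongr; exact le_max_left _ _
  rcases le_total α γ with h | h
  · rw [Set.uIcc_of_le h] at hb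
    rw [max_eq_right h] at E1
    have k := key α γ hα hγ nα nγ cα cγ h ⟨le_rfl, h⟩ hb E1 E2
    have h1 := S.mu_mono hn hα hγ cα h
    rw [abs_of_nonpos (show (mu f ξ n α).re - (mu f ξ n γ).re ≤ 0 by linarith), neg_sub]
    exact k
  · rw [Set.uIcc_of_ge h] at hb
    rw [max_eq_left h] at E1
    rw [abs_sub_comm (ξ n α).re] at E2
    have k := key γ α hγ hα nγ nα cγ cα h ⟨h, le_rfl⟩ hb E1 E2
    have h1 := S.mu_mono hn hγ hα cγ h
    rw [abs_of_nonneg (show 0 ≤ (mu f ξ n α).re - (mu f ξ n γ).re by linarith)]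
    exact k

end Sys
end


lemma num_pos {η th e p D X R Δ : ℝ} (hη : 0 < η) (hη1 : η ≤ 1) (hth : 0 < th)
    (hth1 : th ≤ 1 / 100) (hp : 0 < p) (hp1 : p ≤ 1) (he0 : 0 ≤ e)
    (he : e ≤ 8 / 1000 * (η * th) * p ^ 2) (hD0 : 0 ≤ D) (hD : D ≤ 2 * e) (hR : 0 ≤ R)
    (hΔ : 0 < Δ) (hD' : D ≤ η / 2 * (2 - p) * th * Δ)
    (hX : X * (1 - Real.exp (-Δ)) ≤ (1 + 3 * e) * (D + e * (1 - Real.exp (-Δ))) * R) :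
    X ≤ η / 2 * (2 - p * (1 / 2)) * th * R := by
  set E := 1 - Real.exp (-Δ) with hE
  have hE0 : 0 < E := by
    have := Real.exp_lt_exp.2 (show -Δ < 0 by linarith); rw [Real.exp_zero] at this; linarith
  have hηt : 0 < η * th := mul_pos hη hth
  set g := η * th with hg
  have hg1 : g ≤ 1 / 100 := by nlinarith
  have hp2 : p ^ 2 ≤ p := by nlinarith
  have he1 : e ≤ 8 / 1000 * g * p := he.trans (by gcongr)
  have he2 : e ≤ 8 / 100000 * p := by nlinarith
  have key : (1 + 3 * e) * (D + e * E) ≤ g * (1 - p / 4) * E := by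
    by_cases hc : Δ < p / 16
    · have h1 := @aux_E_le Δ
      have h2 : Δ ≤ (1 + p / 16) * E := by nlinarith
      have h3 : D ≤ g * (1 - p / 2) * ((1 + p / 16) * E) := by
        calc D ≤ g * (1 - p / 2) * Δ := by rw [hg]; linarith
          _ ≤ _ := by gcongr; apply mul_nonneg hηt.le; linarith
      have h4 : D + e * E ≤ (g * (1 - p / 2 + p / 16 + 8 / 1000 * p)) * E := by
        have : e * E ≤ (8 / 1000 * g * p) * E := by gcongr
        have : 0 ≤ g * p * p * E := by positivity
        nlinarith
      have h5 : (1 + 3 * e) * (g * (1 - p / 2 + p / 16 + 8 / 1000 * p)) ≤ g * (1 - p / 4) := by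
        have h6 : (1 + 3 * e) * (1 - p / 2 + p / 16 + 8 / 1000 * p) ≤ 1 - p / 4 := by nlinarith
        nlinarith
      calc _ ≤ (1 + 3 * e) * ((g * (1 - p / 2 + p / 16 + 8 / 1000 * p)) * E) := by gcongr
        _ = ((1 + 3 * e) * (g * (1 - p / 2 + p / 16 + 8 / 1000 * p))) * E := by ring
        _ ≤ _ := by gcongr
    · push Not at hc
      have h1 := @aux_E_le (p / 16)
      have h0 : Real.exp (-Δ) ≤ Real.exp (-(p / 16)) := Real.exp_le_exp.2 (by linarith)
      have h2 : p ≤ 17 * E := by nlinarith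
      have h3 : D ≤ 16 / 1000 * g * p ^ 2 := by linarith
      have h4 : D ≤ 16 / 1000 * g * (17 * E) := by
        refine h3.trans ?_
        gcongr; linarith
      have h5 : e * E ≤ (8 / 1000 * g) * E := by
        gcongr
        nlinarith
      have h6 : D + e * E ≤ (3 / 10 * g) * E := by nlinarith [mul_pos hηt hE0]
      have h7 : 1 + 3 * e ≤ 2 := by nlinarith
      calc _ ≤ 2 * ((3 / 10 * g) * E) := by
            apply mul_le_mul h7 h6 (by positivity) (by norm_num)
        _ = g * (6 / 10) * E := by ring
        _ ≤ _ := by gcongr; linarith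
  have h8 : X * E ≤ (g * (1 - p / 4) * R) * E := by
    refine hX.trans ?_
    calc _ ≤ g * (1 - p / 4) * E * R := by gcongr
      _ = _ := by ring
  have := le_of_mul_le_mul_right h8 hE0
  rw [hg] at this
  linarith

lemma Tr.ne {f : ℝ → ℝ} {A N t : ℕ} {a z : ℝ} (h : Tr f A N t a z) : a ≠ z := by
  induction h with
  | cross a z h1 h2 h3 => exact h2
  | pos A N t a z h1 h2 h3 _ ih => rintro rfl; exact ih rfl
  | neg A N t a z h1 h2 h3 _ ih => rintro rfl; exact ih rfl

def Claim (N : ℕ) (η l0 : ℝ) : Prop :=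
  ∀ (f : ℝ → ℝ) (P : Set ℝ) (q : ℕ) (ell th : ℝ) (w : ℝ → ℝ) (ξ : ℕ → ℝ → ℂ),
    Sys f P q ell th w ξ → l0 ≤ ell → ∀ (A N' t : ℕ) (a z : ℝ), Tr f A N' t a z → N' ≤ N →
    ∀ n, A < n → n ≤ q → a ∈ P → z ∈ P → ∀ b ∈ P, b ∈ Set.uIcc a z →
    |(ξ n a).im - (ξ n b).im| ≤ η * th * |(ξ n a).re - (ξ n z).re|

lemma claim_core {N : ℕ} {η e l1 l0 : ℝ} (hη : 0 < η) (hη1 : η ≤ 1)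
    (he : e = η / (384 * Real.exp (2 * (8 / η))))
    (hprev : ∀ M, M < N → Claim M e l1)
    (h1 : l1 ≤ l0) (h2 : 8 / e ≤ l0) (h3 : 16 / (η / 4) ≤ l0)
    (h4 : 16 / ((η / 4) * Real.exp (-(4 / (η / 4)))) ≤ l0) (h5 : 1000 / η ≤ l0) :
    Claim N η l0 := by
  intro f P q ell th w ξ S hl A N' t a z hT
  have ht := S.th0
  have hee : 0 < e := by rw [he]; positivity
  suffices hs : N' ≤ N → ∀ n, A < n → n ≤ q → a ∈ P → z ∈ P → ∀ b ∈ P, b ∈ Set.uIcc a z →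
      |(ξ n a).im - (ξ n b).im| ≤ (η / 2 * (2 - (1 / 2) ^ t)) * th * |(ξ n a).re - (ξ n z).re| by
    intro hN n hn hq ha hz b hb hb'
    refine (hs hN n hn hq ha hz b hb hb').trans ?_
    gcongr
    have : (0 : ℝ) < (1 / 2) ^ t := by positivity
    nlinarith
  induction hT with
  | cross a z g1 g2 g3 =>
    intro hN n hn hq ha hz b hb hb'
    obtain ⟨n, rfl⟩ : ∃ k, n = k + 1 := ⟨n - 1, by omega⟩
    apply S.reduce (by omega) (by omega) ha hb hz g1 hb'
    have hfb := S.um.uIcc g1 hb'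
    have ha0 : a ≠ 0 := by rintro rfl; simp at g1
    have hz0 : z ≠ 0 := by rintro rfl; simp at g1
    have hb0 : b ≠ 0 := by
      rcases pos_and_pos_or_neg_and_neg_of_mul_pos g1 with ⟨k2, k3⟩ | ⟨k2, k3⟩
      · exact (uIcc_pos k2 k3 hb').ne'
      · exact (uIcc_neg k2 k3 hb').ne
    have := S.cross_step (n := n) (by omega) (S.inv _ ha) (S.inv _ hb) (S.inv _ hz) (S.c_lt ha0)
      (S.c_lt hb0) (S.c_lt hz0) hfb g3 (show 0 < η / 4 by linarith) (h3.trans hl) (h4.trans hl)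
    refine this.trans (le_of_eq ?_)
    simp only [pow_zero]; ring
  | pos A N' t a z g1 g2 g3 hT ih =>
    intro hN n hn hq ha hz b hb hb'
    obtain ⟨n, rfl⟩ : ∃ k, n = k + 1 := ⟨n - 1, by omega⟩
    apply S.reduce (by omega) (by omega) ha hb hz g1 hb'
    have hfb := S.um.uIcc g1 hb'
    have hfb0 := uIcc_pos g2 g3 hfb
    have hI := ih hN n (by omega) (by omega) (S.inv _ ha) (S.inv _ hz) _ (S.inv _ hb) hfb
    have htA := hT.t_lt
    set ε := 8 * th / ell * (1 / 16) ^ t with hε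
    have hv : ∀ y ∈ P, 0 < y → y ∈ Set.uIcc (f a) (f z) → |(ξ n y).im| ≤ ε / 2 ∧
        |dd f ξ n y| ≤ ε := by
      intro y hy hy0 hyu
      have k1 := S.decay (n := n) (t := t) (by omega) (by omega) hy hy0.ne' (hT.iter_pos S.um y hyu)
      have k2 := S.decay (n := n) (t := t) (by omega) (by omega) S.c0 S.c0neg.ne (by
        intro s hs1 hs2
        have hmono : ∀ s, (∀ k, k ≤ s → 0 < f^[k] y) → f^[s] y ≤ f^[s] (f (f 0)) := by
          intro s
          induction s with
          | zero => intro _; simpa using S.hi _ hy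
          | succ s ihs =>
            intro hk
            have h1 := ihs (fun k hks => hk k (by omega))
            have h2 := hk s (by omega)
            rw [Function.iterate_succ_apply', Function.iterate_succ_apply']
            rcases h1.lt_or_eq with h | h
            · exact (S.um.pos _ _ h2.le h).le
            · rw [h]
        have hit : ∀ k, k ≤ t → 0 < f^[k] y := by
          intro k hk
          rcases Nat.eq_zero_or_pos k with rfl | hk0
          · exact hy0
          · exact hT.iter_pos S.um y hyu k hk0 hk
        obtain ⟨s, rfl⟩ : ∃ k, s = k + 1 := ⟨s - 1, by omega⟩
        rw [Function.iterate_succ_apply]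
        exact lt_of_lt_of_le (hit s (by omega)) (hmono s (fun k hk => hit k (by omega))))
      have e1 : 4 * th / ell * (1 / 16) ^ t = ε / 2 := by rw [hε]; ring
      rw [e1] at k1 k2
      refine ⟨k1, (abs_sub _ _).trans (by linarith)⟩
    have va := hv _ (S.inv _ ha) g2 Set.left_mem_uIcc
    have vz := hv _ (S.inv _ hz) g3 Set.right_mem_uIcc
    have vb := hv _ (S.inv _ hb) hfb0 hfb
    have hpp : (1 / 16 : ℝ) ^ t ≤ ((1 / 2) ^ t) ^ 2 := by
      rw [← pow_mul, mul_comm t 2, pow_mul]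
      apply pow_le_pow_left₀ <;> norm_num
    have hp1 : ((1 / 2 : ℝ)) ^ t ≤ 1 := pow_le_one₀ (by norm_num) (by norm_num)
    have hp0 : (0 : ℝ) < (1 / 2) ^ t := by positivity
    have hl' : 8 * th / ell ≤ 8 / 1000 * (η * th) := by
      have hl2 : 1000 / η ≤ ell := h5.trans hl
      rw [div_le_iff₀ hη] at hl2
      have := S.ell1
      rw [div_le_iff₀ (by linarith)]
      nlinarith
    have hell := S.ell1
    have hε1 : ε ≤ 8 / 1000 * (η * th) * ((1 / 2) ^ t) ^ 2 := by
      rw [hε]; gcongr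
    have hε2 : ε ≤ 1 / 10 := by
      refine hε1.trans ?_
      have a1 : η * th ≤ 1 := by nlinarith [S.th1]
      have a2 : ((1 / 2 : ℝ) ^ t) ^ 2 ≤ 1 := pow_le_one₀ hp0.le hp1
      have a3 : 0 < η * th := by positivity
      nlinarith
    have st := S.pos_step (n := n) (by omega) (S.inv _ ha) (S.inv _ hb) (S.inv _ hz) g2 g3 hfb
      va.2 vb.2 vz.2 hε2
    have hΔ : 0 < |(ξ n (f a)).re - (ξ n (f z)).re| := by
      rw [abs_pos, sub_ne_zero]
      rcases lt_or_gt_of_ne hT.ne with h | h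
      · exact (S.r2 n (by omega) _ (S.inv _ hz) _ (S.inv _ ha) (mul_pos g3 g2)
          (by rwa [abs_of_pos g2, abs_of_pos g3])).1.ne
      · exact (S.r2 n (by omega) _ (S.inv _ ha) _ (S.inv _ hz) (mul_pos g2 g3)
          (by rwa [abs_of_pos g2, abs_of_pos g3])).1.ne'
    have fin := num_pos hη hη1 ht S.th1 hp0 hp1 (by positivity) hε1 (abs_nonneg _)
      ((abs_sub _ _).trans (by linarith [va.1, vb.1, abs_nonneg (ξ n (f a)).im, abs_nonneg (ξ n (f b)).im])) (abs_nonneg _) hΔ hI st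
    rw [pow_succ]
    exact fin
  | neg A N' t a z g1 g2 g3 hT ih =>
    intro hN n hn hq ha hz b hb hb'
    obtain ⟨n, rfl⟩ : ∃ k, n = k + 1 := ⟨n - 1, by omega⟩
    apply S.reduce (by omega) (by omega) ha hb hz g1 hb'
    have hfb := S.um.uIcc g1 hb'
    have hfb0 := uIcc_neg g2 g3 hfb
    have ha0 : a ≠ 0 := by rintro rfl; simp at g1
    have hz0 : z ≠ 0 := by rintro rfl; simp at g1
    have hb0 : b ≠ 0 := by
      rcases pos_and_pos_or_neg_and_neg_of_mul_pos g1 with ⟨k2, k3⟩ | ⟨k2, k3⟩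
      · exact (uIcc_pos k2 k3 hb').ne'
      · exact (uIcc_neg k2 k3 hb').ne
    have cα := S.c_lt ha0
    have cβ := S.c_lt hb0
    have cγ := S.c_lt hz0
    have hP := hprev N' (by omega) f P q ell th w ξ S (h1.trans hl)
    have E2 := hP _ _ _ _ _ hT le_rfl n (by omega) (by omega) (S.inv _ ha) (S.inv _ hz) _
      (S.inv _ hb) hfb
    have E1 : |(ξ n (f 0)).im - (ξ n (f b)).im| ≤
        e * th * |(ξ n (f 0)).re - (ξ n (max (f a) (f z))).re| := by
      rcases le_total (f a) (f z) with h | h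
      · rw [max_eq_right h]
        rw [Set.uIcc_of_le h] at hfb
        obtain ⟨A', M, t', hA', hM, hT'⟩ := hT.comb S.um (f 0) (mul_pos_of_neg_of_neg S.c0neg g3)
          (by rw [Set.uIcc_of_le cγ.le]; exact ⟨cα.le, h⟩)
        exact hP _ _ _ _ _ hT' hM n (by omega) (by omega) S.c0 (S.inv _ hz) _
          (S.inv _ hb) (by rw [Set.uIcc_of_le cγ.le]; exact ⟨cβ.le, hfb.2⟩)
      · rw [max_eq_left h]
        rw [Set.uIcc_of_ge h] at hfb
        obtain ⟨A', M, t', hA', hM, hT'⟩ := hT.symm.comb S.um (f 0)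
          (mul_pos_of_neg_of_neg S.c0neg g2)
          (by rw [Set.uIcc_of_le cα.le]; exact ⟨cγ.le, h⟩)
        exact hP _ _ _ _ _ hT' hM n (by omega) (by omega) S.c0 (S.inv _ ha) _
          (S.inv _ hb) (by rw [Set.uIcc_of_le cα.le]; exact ⟨cβ.le, hfb.2⟩)
    have hell := S.ell1
    have h8 : 8 / ell ≤ e := by
      have := h2.trans hl
      rw [div_le_iff₀ hee] at this
      rw [div_le_iff₀ (by linarith)]; linarith
    have st := S.neg_step (n := n) (by omega) (S.inv _ ha) (S.inv _ hb) (S.inv _ hz) g2 g3 cα cβ cγ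
      hfb hee.le h8 (show 0 < 8 / η by positivity) E1 E2
    have hm : max (4 / (8 / η)) (192 * e * Real.exp (2 * (8 / η))) = η / 2 * (2 - (1 / 2) ^ 0) := by
      have a1 : 4 / (8 / η) = η / 2 := by field_simp; norm_num
      have a2 : 192 * e * Real.exp (2 * (8 / η)) = η / 2 := by
        rw [he]; field_simp; norm_num
      rw [a1, a2, max_self]; norm_num
    rw [hm] at st
    exact st

lemma claim_mono {N M : ℕ} {η l0 l1 : ℝ} (h : Claim N η l0) (hM : M ≤ N) (hl : l0 ≤ l1) :
    Claim M η l1 := by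
  intro f P q ell th w ξ S hl' A N' t a z hT hN
  exact h f P q ell th w ξ S (hl.trans hl') A N' t a z hT (hN.trans hM)

lemma claim_all (N : ℕ) : ∀ η : ℝ, 0 < η → η ≤ 1 → ∃ l0, Claim N η l0 := by
  induction N with
  | zero =>
    intro η hη hη1
    set e := η / (384 * Real.exp (2 * (8 / η))) with he
    refine ⟨max (8 / e) (max (16 / (η / 4)) (max (16 / ((η / 4) * Real.exp (-(4 / (η / 4)))))
      (1000 / η))), claim_core (l1 := 8 / e) hη hη1 he (fun M hM => by omega) ?_ ?_ ?_ ?_ ?_⟩ <;>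
      simp
  | succ N ih =>
    intro η hη hη1
    set e := η / (384 * Real.exp (2 * (8 / η))) with he
    have he0 : 0 < e := by positivity
    have he1 : e ≤ 1 := by
      rw [he, div_le_one (by positivity)]
      have := Real.one_le_exp (show 0 ≤ 2 * (8 / η) by positivity)
      linarith
    obtain ⟨l1, hl1⟩ := ih e he0 he1
    refine ⟨max l1 (max (8 / e) (max (16 / (η / 4)) (max (16 / ((η / 4) * Real.exp (-(4 / (η / 4)))))
      (1000 / η)))), claim_core (l1 := l1) hη hη1 he
        (fun M hM => claim_mono hl1 (by omega) le_rfl) ?_ ?_ ?_ ?_ ?_⟩ <;>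
      simp



lemma fml_um {lm lp c : ℝ} (hm : 0 < lm) (hp : 0 < lp) : UM (fml lm lp c) := by
  constructor
  · intro x y hx hxy
    have hy : 0 < y := by linarith
    simp only [fml, if_neg hy.not_ge, abs_of_pos hy]
    split_ifs with h
    · have : x = 0 := by linarith
      subst this
      rw [abs_zero, Real.zero_rpow hm.ne']
      have := Real.rpow_pos_of_pos hy lp
      linarith
    · rw [abs_of_nonneg hx]
      have := Real.rpow_lt_rpow hx hxy hp
      linarith
  · intro x y hxy hy
    have hx : x < 0 := by linarith
    simp only [fml, if_pos hx.le, if_pos hy, abs_of_neg hx, abs_of_nonpos hy]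
    have := Real.rpow_lt_rpow (show 0 ≤ -y by linarith) (neg_lt_neg hxy) hm
    linarith

lemma fml_zero {lm lp c : ℝ} (hm : 0 < lm) : fml lm lp c 0 = c := by
  simp [fml, Real.zero_rpow hm.ne']

lemma fml_ge {lm lp c : ℝ} (x : ℝ) : c ≤ fml lm lp c x := by
  simp only [fml]
  split_ifs
  · have := Real.rpow_nonneg (abs_nonneg x) lm; linarith
  · have := Real.rpow_nonneg (abs_nonneg x) lp; linarith

lemma um_hi {f : ℝ → ℝ} (um : UM f) {q : ℕ} (hq : 1 ≤ q) (h0 : f^[q] 0 = 0)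
    (hlo : ∀ x, f 0 ≤ f x) (hc : f 0 < 0) (n : ℕ) : f^[n] 0 ≤ f (f 0) := by
  have hper : ∀ n, f^[n % q] 0 = f^[n] 0 := by
    intro n
    exact (Function.IsPeriodicPt.iterate_mod_apply (f := f) (n := q) h0 n)
  obtain ⟨k, hk, hmax⟩ := Finset.exists_max_image (Finset.range q) (fun n => f^[n] 0)
    ⟨0, Finset.mem_range.2 hq⟩
  have hm : ∀ n, f^[n] 0 ≤ f^[k] 0 := by
    intro n; rw [← hper n]; exact hmax _ (by simpa using Nat.mod_lt _ hq)
  refine (hm n).trans ?_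
  obtain ⟨j, hj⟩ : ∃ j, f^[k] 0 = f (f^[j] 0) := by
    refine ⟨k + q - 1, ?_⟩
    rw [← Function.iterate_succ_apply' f, show (k + q - 1).succ = k + q by omega, ← hper (k + q),
      Nat.add_mod_right, hper]
  have hcx : f 0 ≤ f^[j] 0 := by
    rcases j with _ | j
    · simpa using hc.le
    · rw [Function.iterate_succ_apply']; exact hlo _
  rcases le_or_gt (f^[j] 0) 0 with hx | hx
  · rw [hj]
    rcases hcx.lt_or_eq with h | h
    · exact (um.neg _ _ h hx).le
    · rw [← h]
  · exfalso
    rcases (hm j).lt_or_eq with h | h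
    · have h1 := um.pos _ _ hx.le h
      have h2 := hm (k + 1)
      rw [Function.iterate_succ_apply'] at h2
      linarith
    · rw [← h] at hj
      have fix : ∀ i, f^[i] (f^[j] 0) = f^[j] 0 := by
        intro i; induction i with
        | zero => rfl
        | succ i ih => rw [Function.iterate_succ_apply', ih, ← hj]
      have h3 : f^[q * j] 0 = 0 := by rw [← hper]; simp
      have h4 := fix (q * j - j)
      rw [← Function.iterate_add_apply, Nat.sub_add_cancel (Nat.le_mul_of_pos_left j hq), h3] at h4
      linarith

lemma orbit_idx {f : ℝ → ℝ} {q : ℕ} (hq : 1 ≤ q) (h0 : f^[q] 0 = 0) {y : ℝ}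
    (hy : ∃ n, f^[n] 0 = y) (hy0 : y ≠ 0) : ∃ n, 1 ≤ n ∧ n < q ∧ f^[n] 0 = y := by
  obtain ⟨n, rfl⟩ := hy
  have hper : f^[n % q] 0 = f^[n] 0 :=
    (Function.IsPeriodicPt.iterate_mod_apply (f := f) (n := q) h0 n)
  refine ⟨n % q, ?_, Nat.mod_lt _ hq, hper⟩
  rcases Nat.eq_zero_or_pos (n % q) with h | h
  · rw [h] at hper; exact absurd hper.symm hy0
  · exact h

/-- Consequence of `exp (-w) ∈ D_θ`. -/
lemma Dsec_fwd {w : ℂ} {th : ℝ} (hth1 : th ≤ 1 / 100) (hw : |w.im| ≤ 1 / 100)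
    (h : Complex.exp (-w) ∈ Dsec th) :
    0 < w.re ∧ |w.im| ≤ 8 / 5 * th * (1 - Real.exp (-w.re)) := by
  obtain ⟨h0, h1, h2⟩ := h
  have e1 : (1 - Complex.exp (-w)) / (0 - Complex.exp (-w)) = 1 - Complex.exp w := by
    rw [zero_sub, Complex.exp_neg]
    have := Complex.exp_ne_zero w
    field_simp
    ring
  rw [ang, e1] at h2
  set Z := 1 - Complex.exp w with hZ
  have hZ0 : Z ≠ 0 := by
    intro h; apply h1
    rw [Complex.exp_neg, ← sub_eq_zero.1 h, inv_one]
  set ph := Real.pi - |Z.arg| with hph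
  have hp0 : 0 ≤ ph := by have := Complex.abs_arg_le_pi Z; linarith
  have hp1 : ph < th := by linarith
  have hn : 0 < ‖Z‖ := norm_pos_iff.2 hZ0
  have hre : Z.re = -(‖Z‖ * Real.cos ph) := by
    rw [hph, Real.cos_pi_sub, Real.cos_abs, mul_neg, neg_neg, Complex.norm_mul_cos_arg]
  have him : |Z.im| = ‖Z‖ * Real.sin ph := by
    rw [hph, Real.sin_pi_sub, ← Complex.norm_mul_sin_arg Z, abs_mul, abs_of_pos hn]
    congr 1
    rcases abs_cases Z.arg with ⟨h, h'⟩ | ⟨h, h'⟩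
    · rw [h, abs_of_nonneg (Real.sin_nonneg_of_nonneg_of_le_pi h' (Complex.arg_le_pi Z))]
    · rw [h, Real.sin_neg, abs_of_nonpos]
      exact Real.sin_nonpos_of_nonpos_of_neg_pi_le h'.le (Complex.neg_pi_lt_arg Z).le
  have hcos : 1 - 1 / 10000 ≤ Real.cos ph := by
    have := Real.one_sub_sq_div_two_le_cos (x := ph); nlinarith
  have hsin : Real.sin ph ≤ th := (Real.sin_le hp0).trans hp1.le
  have hth0 : 0 < th := by linarith
  have hbd : |Z.im| ≤ 101 / 100 * th * (-Z.re) := by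
    rw [him, hre, neg_neg]
    have : Real.sin ph ≤ 101 / 100 * th * Real.cos ph := by nlinarith
    calc _ ≤ ‖Z‖ * (101 / 100 * th * Real.cos ph) := by gcongr
      _ = _ := by ring
  have hZre : Z.re = 1 - Real.exp w.re * Real.cos w.im := by simp [hZ, Complex.exp_re]
  have hZim : Z.im = -(Real.exp w.re * Real.sin w.im) := by simp [hZ, Complex.exp_im]
  have hepos := Real.exp_pos w.re
  have hc1 := Real.cos_le_one w.im
  have hneg : Z.re < 0 := by rw [hre]; have : 0 < ‖Z‖ * Real.cos ph := mul_pos hn (by linarith)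
                             linarith
  have hu : 0 < w.re := by
    by_contra hcon
    have : Real.exp w.re ≤ 1 := Real.exp_le_one_iff.2 (by linarith)
    rw [hZre] at hneg
    nlinarith
  refine ⟨hu, ?_⟩
  rw [hZim, hZre, abs_neg, abs_mul, abs_of_pos hepos] at hbd
  have hE : Real.exp w.re * Real.exp (-w.re) = 1 := by rw [← Real.exp_add]; simp
  have h3 : |Real.sin w.im| ≤ 101 / 100 * th * (1 - Real.exp (-w.re)) := by
    have : Real.exp w.re * |Real.sin w.im| ≤
        Real.exp w.re * (101 / 100 * th * (1 - Real.exp (-w.re))) := by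
      have e : Real.exp w.re * (101 / 100 * th * (1 - Real.exp (-w.re))) =
        101 / 100 * th * (Real.exp w.re - Real.exp w.re * Real.exp (-w.re)) := by ring
      rw [e, hE]
      refine hbd.trans ?_
      have : 0 < 101 / 100 * th := by positivity
      apply mul_le_mul_of_nonneg_left _ this.le
      nlinarith
    exact le_of_mul_le_mul_left this hepos
  have h4 : 2 / Real.pi * |w.im| ≤ |Real.sin w.im| := by
    have := Real.mul_abs_le_abs_sin (x := w.im) (by have := Real.pi_gt_three; linarith)
    exact this
  have hpi : (2 : ℝ) / 3.15 ≤ 2 / Real.pi := by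
    have := Real.pi_lt_d2; have := Real.pi_pos; gcongr
  have hD : 0 ≤ 1 - Real.exp (-w.re) := by
    have := Real.exp_le_one_iff.2 (show -w.re ≤ 0 by linarith); linarith
  have h5 : 2 / 3.15 * |w.im| ≤ |Real.sin w.im| := (by gcongr : _ ≤ 2 / Real.pi * |w.im|).trans h4
  have : 0 ≤ th * (1 - Real.exp (-w.re)) := by positivity
  norm_num at h5
  nlinarith

/-- Sufficient condition for `exp (-w) ∈ D_{θ/2}`. -/
lemma Dsec_bwd {w : ℂ} {th : ℝ} (hth0 : 0 < th) (hth1 : th ≤ 1 / 100) (hu : 0 < w.re)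
    (h1 : |w.im| ≤ 1 / 16 * th * w.re) (h2 : |w.im| ≤ 1 / 20 * th) :
    Complex.exp (-w) ∈ Dsec (th / 2) := by
  have e1 : (1 - Complex.exp (-w)) / (0 - Complex.exp (-w)) = 1 - Complex.exp w := by
    rw [zero_sub, Complex.exp_neg]
    have := Complex.exp_ne_zero w
    field_simp
    ring
  set D := 1 - Real.exp (-w.re) with hD
  have hE := @aux_E_le w.re
  have hD0 : 0 < D := by
    have := Real.exp_lt_exp.2 (show -w.re < 0 by linarith); rw [Real.exp_zero] at this; linarith
  have hD1 : D ≤ 1 := by have := Real.exp_pos (-w.re); linarith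
  have h3 : |w.im| ≤ 1 / 5 * th * D := by
    rcases le_or_gt w.re 1 with h | h
    · have : w.re ≤ 2 * D := by nlinarith
      have : 1 / 16 * th * w.re ≤ 1 / 16 * th * (2 * D) := by gcongr
      nlinarith [mul_pos hth0 hD0]
    · have : 1 / 2 ≤ D := by nlinarith
      nlinarith
  set Z := Complex.exp w - 1 with hZ
  have hZre : Z.re = Real.exp w.re * Real.cos w.im - 1 := by simp [hZ, Complex.exp_re]
  have hZim : Z.im = Real.exp w.re * Real.sin w.im := by simp [hZ, Complex.exp_im]
  have hepos := Real.exp_pos w.re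
  have hEE : Real.exp w.re * Real.exp (-w.re) = 1 := by rw [← Real.exp_add]; simp
  have hcos : 99 / 100 * D ≤ Real.cos w.im - Real.exp (-w.re) := by
    have k := Real.one_sub_sq_div_two_le_cos (x := w.im)
    have : w.im ^ 2 ≤ 1 / 100 * D := by
      rw [← sq_abs]
      have := abs_nonneg w.im
      nlinarith
    linarith
  have hre' : Z.re = Real.exp w.re * (Real.cos w.im - Real.exp (-w.re)) := by
    rw [mul_sub, hEE, hZre]
  have hpos : 0 < Z.re := by rw [hre']; apply mul_pos hepos; nlinarith
  have harg : |Z.arg| < th / 2 := by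
    refine (aux_arg_le hpos).trans_lt ?_
    rw [div_lt_iff₀ hpos, hZim, hre', abs_mul, abs_of_pos hepos]
    have := Real.abs_sin_le_abs (x := w.im)
    have : |Real.sin w.im| < th / 2 * (Real.cos w.im - Real.exp (-w.re)) := by
      nlinarith [mul_pos hth0 hD0]
    nlinarith
  refine ⟨Complex.exp_ne_zero _, ?_, ?_⟩
  · intro h
    rw [Complex.exp_neg, inv_eq_one] at h
    rw [hZ, h] at hpos; simp at hpos
  · rw [ang, e1, show 1 - Complex.exp w = -Z by rw [hZ]; ring]
    rcases lt_trichotomy Z.im 0 with h | h | h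
    · rw [Complex.arg_neg_eq_arg_add_pi_of_im_neg h]
      have := neg_abs_le Z.arg
      have := le_abs_self (Z.arg + Real.pi)
      linarith
    · rw [Complex.arg_eq_pi_iff.2 ⟨by simpa using hpos, by simpa using h⟩, abs_of_pos Real.pi_pos]
      linarith
    · rw [Complex.arg_neg_eq_arg_sub_pi_of_im_pos h]
      have := le_abs_self Z.arg
      have := neg_le_abs (Z.arg - Real.pi)
      linarith


/-- Logarithmic coordinates. -/
noncomputable def xi (H : ℝ → ℂ) (a : ℝ) : ℂ :=
  if 0 < a then Complex.log (H a) else Complex.log (-H a)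

structure Reg (P : Set ℝ) (ell th : ℝ) (H : ℝ → ℂ) : Prop where
  p : ∀ a ∈ P, 0 < a → H a ∈ Ssec (4 * th / ell)
  n : ∀ a ∈ P, a < 0 → -H a ∈ Ssec (4 * th / ell)
  d : ∀ a ∈ P, ∀ b ∈ P, |b| < |a| → 0 < |b| → 0 < a * b → H b / H a ∈ Dsec th

section
variable {P : Set ℝ} {ell th : ℝ} {H : ℝ → ℂ}

lemma Reg.exp_pos (R : Reg P ell th H) {a : ℝ} (ha : a ∈ P) (h : 0 < a) :
    Complex.exp (xi H a) = H a := by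
  rw [xi, if_pos h, Complex.exp_log (R.p a ha h).1]

lemma Reg.exp_neg (R : Reg P ell th H) {a : ℝ} (ha : a ∈ P) (h : a < 0) :
    Complex.exp (xi H a) = -H a := by
  rw [xi, if_neg (by linarith), Complex.exp_log (R.n a ha h).1]

lemma Reg.im (R : Reg P ell th H) {a : ℝ} (ha : a ∈ P) (h : a ≠ 0) :
    |(xi H a).im| < 4 * th / ell := by
  rcases lt_or_gt_of_ne h with h | h
  · rw [xi, if_neg (by linarith), Complex.log_im]; exact (R.n a ha h).2
  · rw [xi, if_pos h, Complex.log_im]; exact (R.p a ha h).2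

lemma eps_small (hth0 : 0 < th) (hth1 : th ≤ 1 / 100) (hell : 100 ≤ ell) :
    4 * th / ell ≤ 1 / 1000 ∧ 4 * th / ell ≤ 1 / 20 * th := by
  constructor <;> rw [div_le_iff₀ (by linarith)] <;> nlinarith

lemma Reg.r2 (R : Reg P ell th H) (hth0 : 0 < th) (hth1 : th ≤ 1 / 100) (hell : 100 ≤ ell)
    {a b : ℝ} (ha : a ∈ P) (hb : b ∈ P) (hab : 0 < a * b) (h : |b| < |a|) :
    (xi H b).re < (xi H a).re ∧ |(xi H a).im - (xi H b).im| ≤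
      8 / 5 * th * (1 - Real.exp (-((xi H a).re - (xi H b).re))) := by
  have ha0 : a ≠ 0 := by rintro rfl; simp at hab
  have hb0 : b ≠ 0 := by rintro rfl; simp at hab
  have hD := R.d a ha b hb h (abs_pos.2 hb0) hab
  have e : Complex.exp (-(xi H a - xi H b)) = H b / H a := by
    rw [neg_sub, Complex.exp_sub]
    rcases pos_and_pos_or_neg_and_neg_of_mul_pos hab with ⟨h2, h3⟩ | ⟨h2, h3⟩
    · rw [R.exp_pos ha h2, R.exp_pos hb h3]
    · rw [R.exp_neg ha h2, R.exp_neg hb h3, neg_div_neg_eq]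
  rw [← e] at hD
  have h1 := R.im ha ha0
  have h2 := R.im hb hb0
  have := Dsec_fwd hth1 (w := xi H a - xi H b) (by
    rw [Complex.sub_im]
    refine (abs_sub _ _).trans ?_
    have := (eps_small hth0 hth1 hell).1
    linarith) hD
  simpa only [Complex.sub_re, Complex.sub_im, sub_pos] using this

/-- Increment with base point `c`. -/
noncomputable def muc (ξ : ℝ → ℂ) (c y : ℝ) : ℂ :=
  if 0 < y then Complex.log (1 + Complex.exp (ξ y - ξ c))
  else if y < 0 then Complex.log (1 - Complex.exp (ξ y - ξ c)) else 0

lemma Reg.base (R : Reg P ell th H) (hth0 : 0 < th) (hth1 : th ≤ 1 / 100) (hell : 100 ≤ ell)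
    {c y : ℝ} (hc : c ∈ P) (hy : y ∈ P) (hc0 : c < 0) (hcy : c < y) (h0 : y = 0 → H 0 = 0) :
    H y - H c = Complex.exp (xi H c + muc (xi H) c y) ∧
    |(xi H c + muc (xi H) c y).im| < 19 / 10 * th := by
  have hs := eps_small hth0 hth1 hell
  have hcim := R.im hc hc0.ne
  have hcexp := R.exp_neg hc hc0
  have tri : |(xi H c + muc (xi H) c y).im| ≤ |(xi H c).im| + |(muc (xi H) c y).im| := by
    rw [Complex.add_im]; exact abs_add_le _ _
  rcases lt_trichotomy y 0 with h | h | h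
  · have e : muc (xi H) c y = Complex.log (1 - Complex.exp (xi H y - xi H c)) := by
      rw [muc, if_neg (by linarith), if_pos h]
    obtain ⟨r1, r2⟩ := R.r2 hth0 hth1 hell hc hy (mul_pos_of_neg_of_neg hc0 h)
      (by rw [abs_of_neg h, abs_of_neg hc0]; linarith)
    have hr0 := Real.exp_pos (xi H y - xi H c).re
    have hr1 : Real.exp (xi H y - xi H c).re < 1 := by
      rw [← Real.exp_zero]; apply Real.exp_lt_exp.2; rw [Complex.sub_re]; linarith
    have hne := nY_ne (d := (xi H y - xi H c).im) hr0 hr1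
    have harg := nY_arg' (th := 4 / 5 * th) hr0 hr1 (d := (xi H y - xi H c).im) (by
      rw [abs_sub_comm, neg_sub] at r2
      rw [Complex.sub_im, Complex.sub_re]
      linarith)
    rw [← nY_eq] at hne harg
    constructor
    · rw [e, Complex.exp_add, Complex.exp_log hne, mul_sub, mul_one, ← Complex.exp_add,
        add_sub_cancel, hcexp, R.exp_neg hy h]; ring
    · rw [← Complex.log_im, ← e] at harg
      linarith
  · have e : muc (xi H) c y = 0 := by rw [muc, if_neg (by linarith), if_neg (by linarith)]
    rw [e] at tri ⊢
    rw [h, h0 h, add_zero, hcexp]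
    refine ⟨by ring, ?_⟩
    linarith
  · have e : muc (xi H) c y = Complex.log (1 + Complex.exp (xi H y - xi H c)) := by
      rw [muc, if_pos h]
    have hyim := R.im hy h.ne'
    have hd : |(xi H y - xi H c).im| ≤ 1 / 10 * th := by
      rw [Complex.sub_im]; refine (abs_sub _ _).trans ?_; linarith
    have hr0 := Real.exp_pos (xi H y - xi H c).re
    have hne := pY_ne (d := (xi H y - xi H c).im) hr0 (by linarith)
    have harg := pY_arg (d := (xi H y - xi H c).im) hr0 (by linarith)
    rw [← pY_eq] at hne harg
    constructor
    · rw [e, Complex.exp_add, Complex.exp_log hne, mul_add, mul_one, ← Complex.exp_add,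
        add_sub_cancel, hcexp, R.exp_pos hy h]; ring
    · rw [← Complex.log_im, ← e] at harg
      linarith

lemma exp_rpow {s : ℂ} {w : ℝ} (hw : 1 ≤ w) (hs : |s.im| < 1) :
    Complex.exp s ^ (((1 : ℝ) / w : ℝ) : ℂ) = Complex.exp (s / w) ∧
    Complex.log (Complex.exp (s / w)) = s / w := by
  have hpi := Real.pi_gt_three
  have h := abs_lt.1 hs
  constructor
  · rw [Complex.cpow_def_of_ne_zero (Complex.exp_ne_zero _), Complex.log_exp (by linarith)
      (by linarith)]
    congr 1; push_cast; ring
  · have : |(s / (w : ℂ)).im| < 1 := by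
      rw [Complex.div_ofReal_im, abs_div, abs_of_pos (by linarith : 0 < w),
        div_lt_iff₀ (by linarith)]
      linarith
    have h := abs_lt.1 this
    exact Complex.log_exp (by linarith) (by linarith)

lemma exp_not_slit {s : ℂ} (hs : |s.im| < 1) : Complex.exp s ∉ slitRay := by
  rintro ⟨_, h⟩
  rw [Complex.exp_re] at h
  have : 0 < Real.exp s.re * Real.cos s.im := by
    apply mul_pos (Real.exp_pos _)
    have h := abs_lt.1 hs
    apply Real.cos_pos_of_mem_Ioo
    have := Real.pi_gt_three
    constructor <;> linarith
  linarith

lemma exp_slitPlane {s : ℂ} (hs : |s.im| < 1) : Complex.exp s ∈ Complex.slitPlane := by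
  rw [Complex.mem_slitPlane_iff]
  have := exp_not_slit hs
  simp only [slitRay, Set.mem_setOf_eq, not_and, not_le] at this
  by_cases h : (Complex.exp s).im = 0
  · exact Or.inl (this h)
  · exact Or.inr h

end

section
variable {f : ℝ → ℝ} {P : Set ℝ} {q : ℕ} {ell th : ℝ} {w : ℝ → ℝ} {ξ : ℕ → ℝ → ℂ}

lemma Sys.mu_strict (S : Sys f P q ell th w ξ) {n : ℕ} (hn : n < q) {y y' : ℝ} (hy : y ∈ P)
    (hy' : y' ∈ P) (hyc : f 0 < y) (hyy : y < y') : (mu f ξ n y).re < (mu f ξ n y').re := by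
  have npos : ∀ z ∈ P, 0 < z → 0 < (mu f ξ n z).re := by
    intro z hz h
    have hr := RR_pos (f := f) (ξ := ξ) n z
    have hd := (S.dd_le' hn hz h.ne').trans (by norm_num : (1 : ℝ) / 1000 ≤ 1)
    rw [mu_pos h, Complex.log_re]
    apply Real.log_pos
    refine lt_of_lt_of_le ?_ ((le_abs_self _).trans (Complex.abs_re_le_norm _))
    have : 0 < Real.cos (dd f ξ n z) := by
      have h := abs_le.1 hd
      apply Real.cos_pos_of_mem_Ioo
      have := Real.pi_gt_three
      constructor <;> linarith
    simp only [pY]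
    nlinarith [mul_pos hr this]
  have nneg : ∀ z ∈ P, f 0 < z → z < 0 → (mu f ξ n z).re < 0 := by
    intro z hz hzc h
    obtain ⟨h1, h2⟩ := S.neg_small hn hz h hzc
    have hr := RR_pos (f := f) (ξ := ξ) n z
    rw [mu_neg h]
    have := nY_logre hr h1 S.th0.le S.th1 h2
    have := Real.log_neg (show 0 < 1 - RR f ξ n z by linarith) (by linarith)
    linarith
  rcases lt_trichotomy y 0 with h | h | h
  · have k1 := nneg y hy hyc h
    rcases lt_trichotomy y' 0 with h' | h' | h'
    · obtain ⟨a1, a2⟩ := S.neg_small hn hy h hyc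
      obtain ⟨b1, b2⟩ := S.neg_small hn hy' h' (by linarith)
      obtain ⟨c1, c2⟩ := S.RR_lt hn hy' hy (mul_pos_of_neg_of_neg h h')
        (by rw [abs_of_neg h, abs_of_neg h']; linarith)
      have hr := RR_pos (f := f) (ξ := ξ) n y'
      have := nY_mono hr c1.le a1 S.th0.le S.th1 a2 b2 c2
      rw [mu_neg h, mu_neg h']
      have : 0 < (RR f ξ n y - RR f ξ n y') / (1 - RR f ξ n y') / 8 := by
        apply div_pos (div_pos _ _) <;> linarith
      linarith
    · subst h'; rw [mu_zero]; simpa using k1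
    · exact k1.trans (npos _ hy' h')
  · subst h
    rw [mu_zero]; simpa using npos _ hy' hyy
  · have h' : 0 < y' := by linarith
    obtain ⟨c1, c2⟩ := S.RR_lt hn hy hy' (mul_pos h' h)
        (by rw [abs_of_pos h, abs_of_pos h']; linarith)
    have hr := RR_pos (f := f) (ξ := ξ) n y
    have := pY_mono hr c1.le (S.dd_le' hn hy' h'.ne') (S.dd_le' hn hy h.ne') (by norm_num) S.th0.le
      S.th1 c2
    rw [mu_pos h, mu_pos h']
    have : 0 < (1 - 1 / 1000) * (RR f ξ n y' - RR f ξ n y) / (1 + RR f ξ n y') := by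
      apply div_pos (mul_pos _ _) <;> linarith
    linarith

lemma Sys.xi_strict (S : Sys f P q ell th w ξ) {n : ℕ} (hn : n < q) (hn1 : 1 ≤ n) {a b : ℝ}
    (ha : a ∈ P) (hb : b ∈ P) (hab : 0 < a * b) (hlt : |b| < |a|) :
    (ξ (n + 1) b).re < (ξ (n + 1) a).re := by
  have ha0 : a ≠ 0 := by rintro rfl; simp at hab
  have hb0 : b ≠ 0 := by rintro rfl; simp at hab
  have hf : f b < f a := by
    rcases pos_and_pos_or_neg_and_neg_of_mul_pos hab with ⟨h2, h3⟩ | ⟨h2, h3⟩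
    · rw [abs_of_pos h2, abs_of_pos h3] at hlt; exact S.um.pos _ _ h3.le hlt
    · rw [abs_of_neg h2, abs_of_neg h3] at hlt; exact S.um.neg _ _ (by linarith) h3.le
  have hmu := S.mu_strict hn (S.inv _ hb) (S.inv _ ha) (S.c_lt hb0) hf
  have l1 := congrArg Complex.re (S.lift n hn a ha ha0 (fun _ => hn1))
  have l2 := congrArg Complex.re (S.lift n hn b hb hb0 (fun _ => hn1))
  rw [← S.w_eq a b hab] at l2
  simp only [Complex.re_ofReal_mul, Complex.add_re] at l1 l2
  have hw : 0 < w a := by have := S.w_ge a; have := S.ell1; linarith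
  have : w a * (ξ (n + 1) b).re < w a * (ξ (n + 1) a).re := by linarith
  exact lt_of_mul_lt_mul_left this hw.le

end


lemma Reg.inj {P : Set ℝ} {ell th : ℝ} {H : ℝ → ℂ} (R : Reg P ell th H)
    (hs : 4 * th / ell ≤ 1) (h0 : H 0 = 0) : Set.InjOn H P := by
  have hpi := Real.pi_gt_three
  have rep : ∀ a ∈ P, 0 < a → 0 < (H a).re := by
    intro a ha h
    obtain ⟨h1, h2⟩ := R.p a ha h
    have : |(H a).arg| < Real.pi / 2 := by linarith
    rcases Complex.abs_arg_lt_pi_div_two_iff.1 this with h | h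
    · exact h
    · exact absurd h h1
  have ren : ∀ a ∈ P, a < 0 → (H a).re < 0 := by
    intro a ha h
    obtain ⟨h1, h2⟩ := R.n a ha h
    have : |(-H a).arg| < Real.pi / 2 := by linarith
    rcases Complex.abs_arg_lt_pi_div_two_iff.1 this with h | h
    · simpa using h
    · exact absurd h h1
  have ne : ∀ a ∈ P, a ≠ 0 → H a ≠ 0 := by
    intro a ha h h'
    rcases lt_or_gt_of_ne h with h | h
    · have := ren a ha h; rw [h'] at this; simp at this
    · have := rep a ha h; rw [h'] at this; simp at this
  have same : ∀ a ∈ P, ∀ b ∈ P, 0 < a * b → |b| < |a| → H a ≠ H b := by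
    intro a ha b hb hab hlt he
    have ha0 : a ≠ 0 := by rintro rfl; simp at hab
    have hb0 : b ≠ 0 := by rintro rfl; simp at hab
    have := (R.d a ha b hb hlt (abs_pos.2 hb0) hab).2.1
    rw [he] at this
    exact this (div_self (ne b hb hb0))
  have same' : ∀ a ∈ P, ∀ b ∈ P, 0 < a * b → H a = H b → a = b := by
    intro a ha b hb hab he
    rcases lt_trichotomy |b| |a| with h | h | h
    · exact absurd he (same a ha b hb hab h)
    · rcases pos_and_pos_or_neg_and_neg_of_mul_pos hab with ⟨h2, h3⟩ | ⟨h2, h3⟩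
      · rw [abs_of_pos h2, abs_of_pos h3] at h; exact h.symm
      · rw [abs_of_neg h2, abs_of_neg h3] at h; linarith
    · exact absurd he.symm (same b hb a ha (by rwa [mul_comm]) h)
  intro a ha b hb he
  rcases lt_trichotomy a 0 with h | h | h <;> rcases lt_trichotomy b 0 with h' | h' | h'
  · exact same' a ha b hb (mul_pos_of_neg_of_neg h h') he
  · rw [h', h0] at he; exact absurd he (ne a ha h.ne)
  · have := ren a ha h; have := rep b hb h'; rw [he] at *; linarith
  · rw [h, h0] at he; exact absurd he.symm (ne b hb h'.ne)
  · rw [h, h']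
  · rw [h, h0] at he; exact absurd he.symm (ne b hb h'.ne')
  · have := rep a ha h; have := ren b hb h'; rw [he] at *; linarith
  · rw [h', h0] at he; exact absurd he (ne a ha h.ne')
  · exact same' a ha b hb (mul_pos h h') he

section
variable {lm lp cc : ℝ}

lemma orbit_inv {y : ℝ} (hy : y ∈ orbitSet lm lp cc) : fml lm lp cc y ∈ orbitSet lm lp cc := by
  obtain ⟨n, rfl⟩ := hy
  exact ⟨n + 1, by rw [Function.iterate_succ_apply']⟩

lemma orbit_zero : (0 : ℝ) ∈ orbitSet lm lp cc := ⟨0, rfl⟩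

lemma lift_formula {th : ℝ} {H : ℝ → ℂ} (hm : 100 ≤ lm) (hp : 100 ≤ lp)
    (hth0 : 0 < th) (hth1 : th ≤ 1 / 100)
    (R : Reg (orbitSet lm lp cc) (min lm lp) th H) (hc : cc < 0) {a : ℝ}
    (ha : a ∈ orbitSet lm lp cc) (ha0 : a ≠ 0) (h0 : fml lm lp cc a = 0 → H 0 = 0) :
    ∃ s : ℂ, s = xi H (fml lm lp cc 0) + muc (xi H) (fml lm lp cc 0) (fml lm lp cc a) ∧
      |s.im| < 19 / 10 * th ∧ H (fml lm lp cc a) - H (fml lm lp cc 0) = Complex.exp s ∧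
      xi (motionLift lm lp cc (fun _ => H) 0) a = s / ((if 0 < a then lp else lm : ℝ) : ℂ) ∧
      (0 < a → motionLift lm lp cc (fun _ => H) 0 a = Complex.exp (s / (lp : ℂ))) ∧
      (a < 0 → motionLift lm lp cc (fun _ => H) 0 a = -Complex.exp (s / (lm : ℂ))) := by
  have hcf : fml lm lp cc 0 = cc := fml_zero (by linarith)
  have um : UM (fml lm lp cc) := fml_um (by linarith) (by linarith)
  have hlt : fml lm lp cc 0 < fml lm lp cc a := by
    rcases lt_or_gt_of_ne ha0 with h | h
    · exact um.neg a 0 h le_rfl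
    · exact um.pos 0 a le_rfl h
  obtain ⟨h1, h2⟩ := R.base hth0 hth1 (le_min hm hp) (orbit_inv orbit_zero) (orbit_inv ha)
    (by rw [hcf]; exact hc) hlt h0
  refine ⟨_, rfl, h2, h1, ?_⟩
  set s := xi H (fml lm lp cc 0) + muc (xi H) (fml lm lp cc 0) (fml lm lp cc a) with hs
  have hs1 : |s.im| < 1 := by linarith
  have ep := exp_rpow (w := lp) (s := s) (by linarith) hs1
  have em := exp_rpow (w := lm) (s := s) (by linarith) hs1
  rcases lt_or_gt_of_ne ha0 with h | h
  · have e : motionLift lm lp cc (fun _ => H) 0 a = -Complex.exp (s / (lm : ℂ)) := by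
      simp only [motionLift]
      rw [if_neg ha0, if_neg (by linarith), h1, em.1]
    refine ⟨?_, fun h' => by linarith, fun _ => e⟩
    rw [xi, if_neg (by linarith), if_neg (by linarith), e, neg_neg, em.2]
  · have e : motionLift lm lp cc (fun _ => H) 0 a = Complex.exp (s / (lp : ℂ)) := by
      simp only [motionLift]
      rw [if_neg ha0, if_pos h, h1, ep.1]
    refine ⟨?_, fun _ => e, fun h' => by linarith⟩
    rw [xi, if_pos h, if_pos h, e, ep.2]

lemma level_sys {th : ℝ} {q : ℕ} {H : ℕ → ℝ → ℂ} (hm : 100 ≤ lm) (hp : 100 ≤ lp)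
    (hth0 : 0 < th) (hth1 : th ≤ 1 / 100) (hq : 1 ≤ q) (hq0 : (fml lm lp cc)^[q] 0 = 0)
    (R : ∀ n < q, Reg (orbitSet lm lp cc) (min lm lp) th (H n)) (hc : cc < 0)
    (hH : ∀ n < q, H (n + 1) = motionLift lm lp cc (fun _ => H n) 0) :
    Sys (fml lm lp cc) (orbitSet lm lp cc) q (min lm lp) th (fun a => if 0 < a then lp else lm)
      (fun n => xi (H n)) := by
  have hcf : fml lm lp cc 0 = cc := fml_zero (by linarith)
  have um : UM (fml lm lp cc) := fml_um (by linarith) (by linarith)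
  have hell : 100 ≤ min lm lp := le_min hm hp
  refine ⟨um, fun y hy => orbit_inv hy, orbit_inv orbit_zero, by rw [hcf]; exact hc, ?_, ?_, hth0,
    hth1, hell, ?_, ?_, ?_, ?_, ?_⟩
  · rintro y ⟨n, rfl⟩
    rw [hcf]
    rcases n with _ | n
    · simpa using hc.le
    · rw [Function.iterate_succ_apply']; exact fml_ge _
  · rintro y ⟨n, rfl⟩
    exact um_hi um hq hq0 (fun x => by rw [hcf]; exact fml_ge x) (by rw [hcf]; exact hc) n
  · intro a
    split_ifs
    · exact min_le_right _ _
    · exact min_le_left _ _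
  · intro a z haz
    rcases pos_and_pos_or_neg_and_neg_of_mul_pos haz with ⟨h2, h3⟩ | ⟨h2, h3⟩
    · rw [if_pos h2, if_pos h3]
    · rw [if_neg (by linarith), if_neg (by linarith)]
  · intro n hn a ha ha0
    exact ((R n hn).im ha ha0).le
  · intro n hn a ha b hb hab hlt
    obtain ⟨h1, h2⟩ := (R n hn).r2 hth0 hth1 hell ha hb hab hlt
    refine ⟨h1, h2.trans ?_⟩
    have : Real.exp (-((xi (H n) a).re - (xi (H n) b).re)) ≤ 1 :=
      Real.exp_le_one_iff.2 (by linarith)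
    have : 0 ≤ th * (1 - Real.exp (-((xi (H n) a).re - (xi (H n) b).re))) :=
      mul_nonneg hth0.le (by linarith)
    linarith
  · intro n hn a ha ha0 h0
    obtain ⟨s, hs, -, -, h4, -⟩ := lift_formula hm hp hth0 hth1 (R n hn) hc ha ha0 (by
      intro h
      obtain ⟨k, rfl⟩ : ∃ k, n = k + 1 := ⟨n - 1, by have := h0 h; omega⟩
      rw [hH k (by omega)]; simp [motionLift])
    rw [hH n hn, h4, mul_div_cancel₀]
    · exact hs
    · norm_cast
      split_ifs <;> linarith

lemma level_main {th l0 : ℝ} {q L : ℕ} {H : ℕ → ℝ → ℂ} (hm : 100 ≤ lm) (hp : 100 ≤ lp)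
    (hC : Claim L (1 / 16) l0) (hl0 : l0 ≤ min lm lp)
    (hth0 : 0 < th) (hth1 : th ≤ 1 / 100) (hq : 2 ≤ q) (hq0 : (fml lm lp cc)^[q] 0 = 0)
    (hne : ∀ j, 1 ≤ j → j < q → (fml lm lp cc)^[j] 0 ≠ 0)
    (hL : Set.ncard {j : ℕ | 1 ≤ j ∧ j < q ∧ (fml lm lp cc)^[j] 0 < 0} ≤ L)
    (R : ∀ n < q, Reg (orbitSet lm lp cc) (min lm lp) th (H n)) (hc : cc < 0)
    (hH : ∀ n < q, H (n + 1) = motionLift lm lp cc (fun _ => H n) 0) :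
    (∀ a ∈ orbitSet lm lp cc, a ≠ 0 → ∃ s : ℂ, |s.im| < 1 ∧
      H (q - 1) (fml lm lp cc a) - H (q - 1) (fml lm lp cc 0) = Complex.exp s) ∧
    Reg (orbitSet lm lp cc) (min lm lp) (th / 2) (H q) := by
  have hell : 100 ≤ min lm lp := le_min hm hp
  have S := level_sys hm hp hth0 hth1 (by omega) hq0 R hc hH
  have LF := fun a ha ha0 => lift_formula (a := a) hm hp hth0 hth1 (R (q - 1) (by omega)) hc ha ha0
    (fun _ => by
      rw [show q - 1 = (q - 2) + 1 by omega, hH (q - 2) (by omega)]; simp [motionLift])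
  have hHq : H q = motionLift lm lp cc (fun _ => H (q - 1)) 0 := by
    rw [← hH (q - 1) (by omega), Nat.sub_add_cancel (by omega)]
  have him : ∀ a ∈ orbitSet lm lp cc, a ≠ 0 → |(xi (H q) a).im| < 4 * (th / 2) / min lm lp := by
    intro a ha ha0
    obtain ⟨s, -, hs, -, h4, -⟩ := LF a ha ha0
    rw [← hHq] at h4
    rw [h4, Complex.div_ofReal_im, abs_div]
    have hw : min lm lp ≤ (if 0 < a then lp else lm : ℝ) := by
      split_ifs
      · exact min_le_right _ _
      · exact min_le_left _ _
    rw [abs_of_pos (by linarith : 0 < (if 0 < a then lp else lm : ℝ))]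
    apply div_lt_div₀ _ hw _ (by linarith) <;> linarith
  have hexp : ∀ a ∈ orbitSet lm lp cc, a ≠ 0 →
      Complex.exp (xi (H q) a) = if 0 < a then H q a else - H q a := by
    intro a ha ha0
    obtain ⟨s, -, -, -, h4, h5, h6⟩ := LF a ha ha0
    rw [← hHq] at h4 h5 h6
    rw [h4]
    rcases lt_or_gt_of_ne ha0 with h | h
    · rw [if_neg (by linarith), if_neg (by linarith), h6 h, neg_neg]
    · rw [if_pos h, if_pos h, h5 h]
  refine ⟨?_, ?_, ?_, ?_⟩
  · intro a ha ha0
    obtain ⟨s, -, hs, h3, -⟩ := LF a ha ha0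
    exact ⟨s, by linarith, h3⟩
  · intro a ha h
    have h1 := him a ha h.ne'
    have h2 := hexp a ha h.ne'
    rw [if_pos h] at h2
    rw [xi, if_pos h, Complex.log_im] at h1
    exact ⟨by rw [← h2]; exact Complex.exp_ne_zero _, h1⟩
  · intro a ha h
    have h1 := him a ha h.ne
    have h2 := hexp a ha h.ne
    rw [if_neg (by linarith)] at h2
    rw [xi, if_neg (by linarith), Complex.log_im] at h1
    exact ⟨by rw [← h2]; exact Complex.exp_ne_zero _, h1⟩
  · intro a ha b hb hlt _ hab
    have ha0 : a ≠ 0 := by rintro rfl; simp at hab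
    have hb0 : b ≠ 0 := by rintro rfl; simp at hab
    have e : Complex.exp (-(xi (H q) a - xi (H q) b)) = H q b / H q a := by
      rw [neg_sub, Complex.exp_sub, hexp a ha ha0, hexp b hb hb0]
      rcases pos_and_pos_or_neg_and_neg_of_mul_pos hab with ⟨h2, h3⟩ | ⟨h2, h3⟩
      · rw [if_pos h2, if_pos h3]
      · rw [if_neg (by linarith), if_neg (by linarith), neg_div_neg_eq]
    rw [← e]
    have hst := S.xi_strict (n := q - 1) (by omega) (by omega) ha hb hab hlt
    simp only [Nat.sub_add_cancel (show 1 ≤ q by omega)] at hst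
    have hcl : |(xi (H q) a).im - (xi (H q) b).im| ≤
        1 / 16 * th * |(xi (H q) a).re - (xi (H q) b).re| := by
      have gen : ∀ i j, 1 ≤ i → i < j → j < q →
          0 < (fml lm lp cc)^[i] 0 * (fml lm lp cc)^[j] 0 →
          |(xi (H q) ((fml lm lp cc)^[i] 0)).im - (xi (H q) ((fml lm lp cc)^[j] 0)).im| ≤
          1 / 16 * th *
          |(xi (H q) ((fml lm lp cc)^[i] 0)).re - (xi (H q) ((fml lm lp cc)^[j] 0)).re| := by
        intro i j hi hij hj hpos
        obtain ⟨A, N, t, hA, hN, hTr⟩ := Tr.exist hq0 hne (q - j - 1) i j hi hij (by omega) hpos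
        have hN' : N ≤ L := by
          refine hN.trans (le_trans ?_ hL)
          rw [← Set.ncard_coe_finset]
          apply Set.ncard_le_ncard
          · intro k hk
            simp only [Finset.coe_filter, Finset.mem_Ioo, Set.mem_setOf_eq] at hk ⊢
            exact ⟨by omega, hk.1.2, hk.2⟩
          · exact (Set.finite_lt_nat q).subset (fun k hk => hk.2.1)
        exact hC _ _ _ _ _ _ _ S hl0 A N t _ _ hTr hN' q (by omega) le_rfl ⟨i, rfl⟩ ⟨j, rfl⟩ _
          ⟨j, rfl⟩ Set.right_mem_uIcc
      obtain ⟨i, hi1, hi2, rfl⟩ := orbit_idx (by omega) hq0 ha ha0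
      obtain ⟨j, hj1, hj2, rfl⟩ := orbit_idx (by omega) hq0 hb hb0
      rcases lt_trichotomy i j with h | h | h
      · exact gen i j hi1 h hj2 hab
      · subst h; simp at hlt
      · have := gen j i hj1 h hi2 (by rwa [mul_comm])
        rwa [abs_sub_comm, abs_sub_comm (xi (H q) ((fml lm lp cc)^[j] 0)).re] at this
    have i1 := him a ha ha0
    have i2 := him b hb hb0
    apply Dsec_bwd hth0 hth1
    · simpa using hst
    · rw [abs_of_pos (show 0 < (xi (H q) a).re - (xi (H q) b).re by linarith)] at hcl
      exact hcl
    · rw [Complex.sub_im]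
      refine (abs_sub _ _).trans ?_
      have := (eps_small hth0 hth1 hell).2
      have e2 : 4 * (th / 2) / min lm lp = 4 * th / min lm lp / 2 := by ring
      rw [e2] at i1 i2
      linarith
end


lemma lift_id {lm lp cc : ℝ} (hm : 0 < lm) (hp : 0 < lp) {h : ℂ → ℝ → ℂ}
    (hid : ∀ x ∈ orbitSet lm lp cc, h 0 x = (x : ℂ)) {a : ℝ} (ha : a ∈ orbitSet lm lp cc) :
    motionLift lm lp cc h 0 a = (a : ℂ) := by
  simp only [motionLift]
  rw [hid _ (orbit_inv ha), hid _ (orbit_inv orbit_zero), fml_zero hm]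
  rcases lt_trichotomy a 0 with h | h | h
  · rw [if_neg h.ne, if_neg (by linarith), fml, if_pos h.le, abs_of_neg h]
    rw [Complex.ofReal_add]
    rw [add_sub_cancel_right, ← Complex.ofReal_cpow (Real.rpow_nonneg (by linarith) _)]
    rw [← Real.rpow_mul (by linarith), mul_one_div_cancel hm.ne', Real.rpow_one]
    simp
  · rw [if_pos h, h]; simp
  · rw [if_neg h.ne', if_pos h, fml, if_neg (by linarith), abs_of_pos h]
    rw [Complex.ofReal_add]
    rw [add_sub_cancel_right, ← Complex.ofReal_cpow (Real.rpow_nonneg (by linarith) _)]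
    rw [← Real.rpow_mul (by linarith), mul_one_div_cancel hp.ne', Real.rpow_one]

theorem stmt14 (L : ℕ) (hL : 1 ≤ L) :
    ∃ ℓ₀ : ℝ, 1 < ℓ₀ ∧
    ∀ lm lp : ℝ, 1 ≤ lm → 1 ≤ lp → ℓ₀ ≤ min lm lp →
    ∃ θ₀ : ℝ, 0 < θ₀ ∧
    ∀ θ : ℝ, 0 < θ → θ < θ₀ →
    ∀ (cc : ℝ) (q : ℕ), 1 ≤ q →
    (fml lm lp cc)^[q] 0 = 0 →
    (∀ j, 1 ≤ j → j < q → (fml lm lp cc)^[j] 0 ≠ 0) →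
    Set.ncard {j : ℕ | 1 ≤ j ∧ j < q ∧ (fml lm lp cc)^[j] 0 < 0} ≤ L →
    ∀ (Ω : Set ℂ) (h : ℕ → ℂ → ℝ → ℂ),
    (∀ i : ℕ, i + 1 ≤ q →
      IsHoloMotion (orbitSet lm lp cc) Ω (h i) ∧
      ThetaRegular (min lm lp) θ (orbitSet lm lp cc) Ω (h i)) →
    (∀ i : ℕ, i + 2 ≤ q →
      LiftDefined lm lp cc (orbitSet lm lp cc) Ω (h i) ∧
      h (i + 1) = motionLift lm lp cc (h i)) →
    LiftDefined lm lp cc (orbitSet lm lp cc) Ω (h (q - 1)) ∧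
    ThetaRegular (min lm lp) (θ / 2) (orbitSet lm lp cc) Ω
      (motionLift lm lp cc (h (q - 1))) := by
  obtain ⟨l0, hC⟩ := claim_all L (1 / 16) (by norm_num) (by norm_num)
  refine ⟨max 100 l0, lt_of_lt_of_le (by norm_num) (le_max_left _ _), ?_⟩
  intro lm lp _ _ hl
  refine ⟨1 / 100, by norm_num, ?_⟩
  intro θ hθ0 hθ1 cc q hq hq0 hne hLc Ω h hreg hlift
  have hl1 : 100 ≤ min lm lp := (le_max_left _ _).trans hl
  have hl2 : l0 ≤ min lm lp := (le_max_right _ _).trans hl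
  have hm : 100 ≤ lm := hl1.trans (min_le_left _ _)
  have hp : 100 ≤ lp := hl1.trans (min_le_right _ _)
  have hcf : fml lm lp cc 0 = cc := fml_zero (by linarith)
  obtain ⟨⟨hΩ1, hΩ2, hΩ3, hid, hinj, hdiff⟩, -⟩ := hreg (q - 1) (by omega)
  -- the two main facts, uniformly in the parameter
  have key : (∀ l ∈ Ω, ∀ a ∈ orbitSet lm lp cc, a ≠ 0 → ∃ s : ℂ, |s.im| < 1 ∧
      h (q - 1) l (fml lm lp cc a) - h (q - 1) l (fml lm lp cc 0) = Complex.exp s) ∧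
      (∀ l ∈ Ω, Reg (orbitSet lm lp cc) (min lm lp) (θ / 2)
        (motionLift lm lp cc (h (q - 1)) l)) := by
    rcases Nat.lt_or_ge q 2 with hq2 | hq2
    · have hq1 : q = 1 := by omega
      subst hq1
      have hcz : fml lm lp cc 0 = 0 := hq0
      have hP : ∀ a ∈ orbitSet lm lp cc, a = 0 := by
        rintro a ⟨n, rfl⟩
        induction n with
        | zero => rfl
        | succ n ih => rw [Function.iterate_succ_apply', ih, hcz]
      refine ⟨fun l _ a ha ha0 => absurd (hP a ha) ha0, fun l _ => ⟨?_, ?_, ?_⟩⟩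
      · intro a ha h; rw [hP a ha] at h; simp at h
      · intro a ha h; rw [hP a ha] at h; simp at h
      · intro a ha b hb _ h _; rw [hP b hb] at h; simp at h
    · have hc : cc < 0 := by
        rcases lt_trichotomy cc 0 with h | h | h
        · exact h
        · exact absurd (hcf.trans h) (hne 1 le_rfl (by omega))
        · obtain ⟨k, rfl⟩ : ∃ k, q = k + 1 := ⟨q - 1, by omega⟩
          rw [Function.iterate_succ_apply'] at hq0
          have := fml_ge (lm := lm) (lp := lp) (c := cc) ((fml lm lp cc)^[k] 0)
          linarith
      have main : ∀ l ∈ Ω, (∀ a ∈ orbitSet lm lp cc, a ≠ 0 → ∃ s : ℂ, |s.im| < 1 ∧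
          h (q - 1) l (fml lm lp cc a) - h (q - 1) l (fml lm lp cc 0) = Complex.exp s) ∧
          Reg (orbitSet lm lp cc) (min lm lp) (θ / 2)
          (motionLift lm lp cc (h (q - 1)) l) := by
        intro l hlΩ
        have := level_main (cc := cc) (q := q)
          (H := fun n => if n < q then h n l else motionLift lm lp cc (h (q - 1)) l)
          hm hp hC hl2 hθ0 hθ1.le hq2 hq0 hne hLc (by
            intro n hn
            obtain ⟨-, hr⟩ := hreg n (by omega)
            obtain ⟨h1, h2, h3⟩ := hr l hlΩ
            simp only [if_pos hn]
            exact ⟨h1, h2, h3⟩) hc (by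
            intro n hn
            simp only [if_pos hn]
            split_ifs with h'
            · rw [(hlift n (by omega)).2]; rfl
            · have : q - 1 = n := by omega
              rw [this]; rfl)
        simpa only [lt_irrefl, if_false, if_pos (show q - 1 < q by omega)] using this
      exact ⟨fun l hl => (main l hl).1, fun l hl => (main l hl).2⟩
  obtain ⟨k1, k2⟩ := key
  refine ⟨⟨?_, hΩ1, hΩ2, hΩ3, ?_, ?_, ?_⟩, ?_⟩
  · intro l hlΩ a ha ha0
    obtain ⟨s, hs, he⟩ := k1 l hlΩ a ha ha0
    rw [he]; exact exp_not_slit hs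
  · intro x hx
    exact lift_id (by linarith) (by linarith) hid hx
  · intro l hlΩ
    apply (k2 l hlΩ).inj
    · have := (eps_small hθ0 hθ1.le hl1).1
      have e2 : 4 * (θ / 2) / min lm lp = 4 * θ / min lm lp / 2 := by ring
      rw [e2]; linarith
    · simp [motionLift]
  · intro x hx
    have hbase : DifferentiableOn ℂ
        (fun l => h (q - 1) l (fml lm lp cc x) - h (q - 1) l (fml lm lp cc 0)) Ω :=
      (hdiff _ (orbit_inv hx)).sub (hdiff _ (orbit_inv orbit_zero))
    by_cases hx0 : x = 0
    · simp only [motionLift, if_pos hx0]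
      exact differentiableOn_const _
    · have hsl : ∀ l ∈ Ω, h (q - 1) l (fml lm lp cc x) - h (q - 1) l (fml lm lp cc 0) ∈
          Complex.slitPlane := by
        intro l hlΩ
        obtain ⟨s, hs, he⟩ := k1 l hlΩ x hx hx0
        rw [he]; exact exp_slitPlane hs
      by_cases hxp : 0 < x
      · simp only [motionLift, if_neg hx0, if_pos hxp]
        exact hbase.cpow (differentiableOn_const _) hsl
      · simp only [motionLift, if_neg hx0, if_neg hxp]
        exact (hbase.cpow (differentiableOn_const _) hsl).neg
  · intro l hlΩ
    exact ⟨(k2 l hlΩ).p, (k2 l hlΩ).n, (k2 l hlΩ).d⟩
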